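/- arXiv:2410.22676 — 2 statements merged into one kernel-verified Lean document; each statement's English description precedes it below -/
import Mathlib

section
/- Let n > 2k with k ≥ 2. If F ⊆ ([n] choose k) is an intersecting family with ⋂_{F∈F} F = ∅ (i.e., F is non-trivially intersecting), then |F| ≤ C(n-1,k-1) - C(n-k-1,k-1) + 1. -/
open Finset

section IntersectingFamilies

variable {α : Type*} [DecidableEq α]

/-- A non-trivial intersecting family of `k`-subsets of `X`. -/
structure IsNontrivialIntersecting (X : Finset α) (k : ℕ) (F : Finset (Finset α)) : Prop where
  subset_powersetCard : F ⊆ X.powersetCard k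
  inter_nonempty : ∀ A ∈ F, ∀ B ∈ F, (A ∩ B).Nonempty
  exists_notMem : ∀ p, ∃ A ∈ F, p ∉ A

lemma compress_singleton (a b : α) (A : Finset α) :
    UV.compress {a} {b} A = if a ∉ A ∧ b ∈ A then (A ∪ {a}) \ {b} else A := by
  simp [UV.compress]

lemma mem_compression_singleton_cases {a b : α} {F : Finset (Finset α)} {A : Finset α}
    (hA : A ∈ UV.compression {a} {b} F) :
    (A ∈ F ∧ (a ∉ A → b ∈ A → (A ∪ {a}) \ {b} ∈ F)) ∨
      ∃ B ∈ F, a ∉ B ∧ b ∈ B ∧ A = (B ∪ {a}) \ {b} := by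
  rw [UV.mem_compression] at hA
  rcases hA with ⟨h, h'⟩ | ⟨h, B, hB, rfl⟩
  · left
    refine ⟨h, fun ha hb => ?_⟩
    rwa [compress_singleton, if_pos ⟨ha, hb⟩] at h'
  · right
    rw [compress_singleton] at h ⊢
    split_ifs at h ⊢ with hc
    · exact ⟨B, hB, hc.1, hc.2, rfl⟩
    · exact absurd hB h

lemma compression_inter_nonempty {a b : α} (hab : a ≠ b) {F : Finset (Finset α)}
    (hF : ∀ A ∈ F, ∀ B ∈ F, (A ∩ B).Nonempty) :
    ∀ A ∈ UV.compression {a} {b} F, ∀ B ∈ UV.compression {a} {b} F, (A ∩ B).Nonempty := by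
  have key : ∀ A ∈ F, (a ∉ A → b ∈ A → (A ∪ {a}) \ {b} ∈ F) → ∀ B ∈ F, a ∉ B → b ∈ B →
      (A ∩ ((B ∪ {a}) \ {b})).Nonempty := by
    intro A hA hA' B hB haB hbB
    by_cases haA : a ∈ A
    · exact ⟨a, by simp [haA, hab]⟩
    by_cases hbA : b ∈ A
    · obtain ⟨z, hz⟩ := hF _ (hA' haA hbA) _ hB
      refine ⟨z, ?_⟩
      simp only [mem_inter, mem_sdiff, mem_union, mem_singleton] at hz ⊢
      grind
    · obtain ⟨z, hz⟩ := hF _ hA _ hB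
      refine ⟨z, ?_⟩
      simp only [mem_inter, mem_sdiff, mem_union, mem_singleton] at hz ⊢
      grind
  intro A hA B hB
  rcases mem_compression_singleton_cases hA with ⟨hA₁, hA₂⟩ | ⟨A, hA₁, haA, hbA, rfl⟩ <;>
  rcases mem_compression_singleton_cases hB with ⟨hB₁, hB₂⟩ | ⟨B, hB₁, haB, hbB, rfl⟩
  · exact hF A hA₁ B hB₁
  · exact key A hA₁ hA₂ B hB₁ haB hbB
  · rw [inter_comm]
    exact key B hB₁ hB₂ A hA₁ haA hbA
  · exact ⟨a, by simp [hab]⟩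

lemma compression_subset_powersetCard {a b : α} {X : Finset α} {k : ℕ} (ha : a ∈ X)
    {F : Finset (Finset α)} (hF : F ⊆ X.powersetCard k) :
    UV.compression {a} {b} F ⊆ X.powersetCard k := by
  intro A hA
  rcases mem_compression_singleton_cases hA with ⟨hA₁, -⟩ | ⟨A, hA₁, haA, hbA, rfl⟩
  · exact hF hA₁
  · have h := mem_powersetCard.1 (hF hA₁)
    have hab : b ≠ a := fun h => haA (h ▸ hbA)
    refine mem_powersetCard.2 ⟨?_, ?_⟩
    · exact sdiff_subset.trans (union_subset h.1 (by simpa using ha))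
    · rw [card_sdiff_of_subset (by simp [hbA]), card_union_of_disjoint (by simpa using haA)]
      simpa using h.2

lemma sum_card_sdiff_compression_lt {a b : α} {Y : Finset α} (ha : a ∈ Y) (hb : b ∉ Y)
    {F : Finset (Finset α)} (hne : UV.compression {a} {b} F ≠ F) :
    ∑ A ∈ UV.compression {a} {b} F, #(A \ Y) < ∑ A ∈ F, #(A \ Y) := by
  have hlt : ∀ A ∈ F.filter (fun A => UV.compress {a} {b} A ∉ F),
      #(UV.compress {a} {b} A \ Y) < #(A \ Y) := by
    intro A hA
    rw [mem_filter] at hA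
    have hc : a ∉ A ∧ b ∈ A := by
      by_contra hc
      rw [compress_singleton, if_neg hc] at hA
      exact hA.2 hA.1
    rw [compress_singleton, if_pos hc]
    refine card_lt_card ⟨fun z hz => ?_, fun h => ?_⟩
    · simp only [mem_sdiff, mem_union, mem_singleton] at hz ⊢
      grind
    · have := h (mem_sdiff.2 ⟨hc.2, hb⟩)
      simp at this
  have hnonempty : (F.filter (fun A => UV.compress {a} {b} A ∉ F)).Nonempty := by
    rw [nonempty_iff_ne_empty]
    intro he
    apply hne
    have hall : ∀ A ∈ F, UV.compress {a} {b} A ∈ F := by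
      intro A hA
      by_contra h
      exact notMem_empty A (he ▸ mem_filter.2 ⟨hA, h⟩)
    ext A
    rw [UV.mem_compression]
    constructor
    · rintro (h | ⟨h, B, hB, rfl⟩)
      · exact h.1
      · exact hall B hB
    · exact fun h => Or.inl ⟨h, hall A h⟩
  have himage : (F.image (UV.compress {a} {b})).filter (fun A => A ∉ F) =
      (F.filter (fun A => UV.compress {a} {b} A ∉ F)).image (UV.compress {a} {b}) := by
    rw [filter_image]
  rw [UV.compression, sum_union UV.compress_disjoint, himage, sum_image UV.compress_injOn,
    ← sum_filter_add_sum_filter_not F (fun A => UV.compress {a} {b} A ∈ F) (fun A => #(A \ Y))]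
  exact Nat.add_lt_add_left (sum_lt_sum_of_nonempty hnonempty hlt) _

/-- Among the families obtained from `F` by moving elements into `Y` while keeping a property `P`,
there is one that no further compression can change without losing `P`. -/
lemma exists_compression_stable (P : Finset (Finset α) → Prop) (Y : Finset α)
    (F : Finset (Finset α)) (hF : P F) :
    ∃ G, P G ∧ #G = #F ∧ ∀ a ∈ Y, ∀ b ∉ Y,
      P (UV.compression {a} {b} G) → UV.compression {a} {b} G = G := by
  induction hw : ∑ A ∈ F, #(A \ Y) using Nat.strong_induction_on generalizing F with
  | _ w ih =>
    by_cases hs : ∀ a ∈ Y, ∀ b ∉ Y,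
      P (UV.compression {a} {b} F) → UV.compression {a} {b} F = F
    · exact ⟨F, hF, rfl, hs⟩
    push Not at hs
    obtain ⟨a, ha, b, hb, hP, hne⟩ := hs
    obtain ⟨G, hG, hcard, hst⟩ :=
      ih _ (hw ▸ sum_card_sdiff_compression_lt ha hb hne) _ hP rfl
    exact ⟨G, hG, hcard.trans (UV.card_compression _ _ _), hst⟩

/-- If a family is closed under the exchanges moving elements from outside `Y` into `Y \ T`, then
its members already intersect inside `Y`. -/
lemma inter_inter_nonempty_of_stable {X Y T : Finset α} {k : ℕ} {F : Finset (Finset α)}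
    (hF : F ⊆ X.powersetCard k) (hint : ∀ A ∈ F, ∀ B ∈ F, (A ∩ B).Nonempty)
    (hY : #Y = 2 * k) (hTY : T ⊆ Y)
    (hT : ∀ A ∈ F, ∀ B ∈ F, A ∩ B ∩ T = ∅ → T ⊆ A ∪ B)
    (hst : ∀ a ∈ Y \ T, ∀ b ∈ X \ Y, UV.compression {a} {b} F = F) :
    ∀ A ∈ F, ∀ B ∈ F, (A ∩ B ∩ Y).Nonempty := by
  intro A hA B hB
  induction hm : #(A ∩ B) using Nat.strong_induction_on generalizing A with
  | _ m ih =>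
    by_contra hne
    rw [not_nonempty_iff_eq_empty] at hne
    obtain ⟨b, hb⟩ := hint A hA B hB
    have hbY : b ∉ Y := fun h => notMem_empty b (hne ▸ mem_inter.2 ⟨hb, h⟩)
    obtain ⟨hbA, hbB⟩ := mem_inter.1 hb
    have hA' := mem_powersetCard.1 (hF hA)
    have hB' := mem_powersetCard.1 (hF hB)
    have hTAB : T ⊆ A ∪ B :=
      hT A hA B hB (subset_empty.1 (hne ▸ inter_subset_inter_left hTY))
    obtain ⟨a, haY, haAB⟩ : ∃ a ∈ Y, a ∉ A.erase b ∪ B.erase b := by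
      apply exists_mem_notMem_of_card_lt_card
      have h1 := card_union_le (A.erase b) (B.erase b)
      have h2 := card_erase_lt_of_mem hbA
      have h3 := card_erase_lt_of_mem hbB
      omega
    have hab : a ≠ b := fun h => hbY (h ▸ haY)
    simp only [mem_union, mem_erase, ne_eq, hab, not_false_eq_true, true_and, not_or] at haAB
    have haT : a ∉ T := fun h => by simpa [haAB] using hTAB h
    have hmem : (A ∪ {a}) \ {b} ∈ F := by
      have h := UV.compress_mem_compression (u := {a}) (v := {b}) hA
      rwa [hst a (mem_sdiff.2 ⟨haY, haT⟩) b (mem_sdiff.2 ⟨hA'.1 hbA, hbY⟩), compress_singleton,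
        if_pos ⟨haAB.1, hbA⟩] at h
    have hlt : #((A ∪ {a}) \ {b} ∩ B) < m := by
      rw [← hm]
      refine card_lt_card ⟨fun z hz => ?_, fun h => ?_⟩
      · simp only [mem_inter, mem_sdiff, mem_union, mem_singleton] at hz ⊢
        grind
      · have := h hb
        simp at this
    obtain ⟨z, hz⟩ := ih _ hlt _ hmem rfl
    apply notMem_empty z
    rw [← hne]
    simp only [mem_inter, mem_sdiff, mem_union, mem_singleton] at hz ⊢
    grind

/-- The traces on `Y`, of size `i`, of the members of `F`. -/
def traceOfCard (F : Finset (Finset α)) (Y : Finset α) (i : ℕ) : Finset (Finset α) :=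
  (F.image (· ∩ Y)).filter (fun B => #B = i)

lemma mem_traceOfCard {F : Finset (Finset α)} {Y B : Finset α} {i : ℕ} :
    B ∈ traceOfCard F Y i ↔ (∃ A ∈ F, A ∩ Y = B) ∧ #B = i := by
  simp [traceOfCard]

lemma card_le_sum_card_traceOfCard {X Y : Finset α} {k : ℕ} {F : Finset (Finset α)}
    (hF : F ⊆ X.powersetCard k) (hYX : Y ⊆ X) :
    #F ≤ ∑ i ∈ range (k + 1), #(traceOfCard F Y i) * (#X - #Y).choose (k - i) := by
  have hfiber : ∀ B ∈ F.image (· ∩ Y),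
      #(F.filter (fun A => A ∩ Y = B)) ≤ (#X - #Y).choose (k - #B) := by
    intro B _
    rw [← card_sdiff_of_subset hYX, ← card_powersetCard]
    refine card_le_card_of_injOn (· \ Y) (fun A hA => ?_) (fun A hA A' hA' h => ?_)
    · obtain ⟨hAF, rfl⟩ := mem_filter.1 hA
      have h := mem_powersetCard.1 (hF hAF)
      refine mem_coe.2 (mem_powersetCard.2 ⟨sdiff_subset_sdiff h.1 le_rfl, ?_⟩)
      have := card_sdiff_add_card_inter A Y
      dsimp only
      omega
    · have h1 := (mem_filter.1 hA).2
      have h2 := (mem_filter.1 hA').2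
      dsimp only at h
      rw [← sdiff_union_inter A Y, ← sdiff_union_inter A' Y, h, h1, h2]
  have hmaps : ∀ B ∈ F.image (· ∩ Y), #B ∈ range (k + 1) := by
    intro B hB
    obtain ⟨A, hA, rfl⟩ := mem_image.1 hB
    have h := (mem_powersetCard.1 (hF hA)).2
    have := card_le_card (inter_subset_left : A ∩ Y ⊆ A)
    rw [mem_range]
    omega
  calc #F = ∑ B ∈ F.image (· ∩ Y), #(F.filter (fun A => A ∩ Y = B)) :=
        card_eq_sum_card_image _ _
    _ ≤ ∑ B ∈ F.image (· ∩ Y), (#X - #Y).choose (k - #B) := sum_le_sum hfiber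
    _ = ∑ i ∈ range (k + 1), ∑ B ∈ traceOfCard F Y i, (#X - #Y).choose (k - #B) :=
        (sum_fiberwise_of_maps_to hmaps _).symm
    _ = _ := by
      refine sum_congr rfl fun i _ => ?_
      rw [sum_congr rfl (g := fun _ => (#X - #Y).choose (k - i)), sum_const, smul_eq_mul]
      intro B hB
      rw [(mem_traceOfCard.1 hB).2]

/-- Half of the `k`-subsets of a `2k`-set is the most an intersecting family can contain. -/
lemma two_mul_card_le_of_intersecting {Y : Finset α} {k : ℕ} {F : Finset (Finset α)}
    (hY : #Y = 2 * k) (hF : F ⊆ Y.powersetCard k)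
    (hint : ∀ A ∈ F, ∀ B ∈ F, (A ∩ B).Nonempty) : 2 * #F ≤ (2 * k).choose k := by
  have hinj : Set.InjOn (Y \ ·) (F : Set (Finset α)) := by
    intro A hA B hB h
    have hA' := (mem_powersetCard.1 (hF hA)).1
    have hB' := (mem_powersetCard.1 (hF hB)).1
    dsimp only at h
    rw [← Finset.sdiff_sdiff_eq_self hA', h, Finset.sdiff_sdiff_eq_self hB']
  have hdisj : Disjoint F (F.image (Y \ ·)) := by
    rw [disjoint_left]
    intro A hA hA'
    obtain ⟨B, hB, rfl⟩ := mem_image.1 hA'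
    obtain ⟨z, hz⟩ := hint _ hA _ hB
    simp at hz
  have hsub : F ∪ F.image (Y \ ·) ⊆ Y.powersetCard k := by
    refine union_subset hF (image_subset_iff.2 fun A hA => ?_)
    have h := mem_powersetCard.1 (hF hA)
    refine mem_powersetCard.2 ⟨sdiff_subset, ?_⟩
    rw [card_sdiff_of_subset h.1]
    omega
  have := card_le_card hsub
  rw [card_union_of_disjoint hdisj, card_image_of_injOn hinj, card_powersetCard, hY] at this
  omega

/-- The members of a star that all meet a fixed set avoiding the centre. -/
lemma card_add_choose_le_of_star {Y C : Finset α} {p : α} {i k : ℕ} {F : Finset (Finset α)}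
    (hY : #Y = 2 * k) (hk : 1 ≤ k) (hF : F ⊆ Y.powersetCard (i + 1)) (hp : ∀ A ∈ F, p ∈ A)
    (hpC : p ∉ C) (hC : #C ≤ k) (hFC : ∀ A ∈ F, (A ∩ C).Nonempty) :
    #F + (k - 1).choose i ≤ (2 * k - 1).choose i := by
  obtain rfl | ⟨A₀, hA₀⟩ := F.eq_empty_or_nonempty
  · simpa using Nat.choose_le_choose i (by omega)
  have hpY : p ∈ Y := (mem_powersetCard.1 (hF hA₀)).1 (hp _ hA₀)
  have hinj : Set.InjOn (fun A : Finset α => A.erase p) (F : Set (Finset α)) := by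
    intro A hA B hB h
    dsimp only at h
    rw [← insert_erase (hp A hA), h, insert_erase (hp B hB)]
  have hdisj : Disjoint (F.image (fun A => A.erase p)) ((Y.erase p \ C).powersetCard i) := by
    rw [disjoint_left]
    intro A hA hA'
    obtain ⟨B, hB, rfl⟩ := mem_image.1 hA
    obtain ⟨z, hz⟩ := hFC B hB
    rw [mem_inter] at hz
    have hzp : z ≠ p := fun h => hpC (h ▸ hz.2)
    have := (mem_powersetCard.1 hA').1 (mem_erase.2 ⟨hzp, hz.1⟩)
    exact (mem_sdiff.1 this).2 hz.2
  have hsub : F.image (fun A => A.erase p) ∪ (Y.erase p \ C).powersetCard i ⊆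
      (Y.erase p).powersetCard i := by
    refine union_subset (image_subset_iff.2 fun A hA => ?_) (powersetCard_mono sdiff_subset)
    have h := mem_powersetCard.1 (hF hA)
    refine mem_powersetCard.2 ⟨erase_subset_erase p h.1, ?_⟩
    rw [card_erase_of_mem (hp A hA), h.2, Nat.add_sub_cancel]
  have hcard := card_le_card hsub
  rw [card_union_of_disjoint hdisj, card_image_of_injOn hinj, card_powersetCard,
    card_powersetCard, card_erase_of_mem hpY, hY] at hcard
  have hle : (k - 1).choose i ≤ (#(Y.erase p \ C)).choose i := by
    apply Nat.choose_le_choose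
    have h := le_card_sdiff C (Y.erase p)
    rw [card_erase_of_mem hpY] at h
    omega
  omega

lemma card_traceOfCard_add_choose_le {X Y : Finset α} {k i : ℕ} {F : Finset (Finset α)}
    (hF : IsNontrivialIntersecting X k F) (hY : #Y = 2 * k) (hik : i + 1 < k)
    (hFY : ∀ A ∈ F, ∀ B ∈ F, (A ∩ B ∩ Y).Nonempty)
    (ih : ∀ G, 1 ≤ i → IsNontrivialIntersecting Y (i + 1) G →
      #G + (2 * k - (i + 1) - 1).choose i ≤ (2 * k - 1).choose i + 1) :
    #(traceOfCard F Y (i + 1)) + (k - 1).choose i ≤ (2 * k - 1).choose i := by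
  have hsub : traceOfCard F Y (i + 1) ⊆ Y.powersetCard (i + 1) := by
    intro B hB
    obtain ⟨⟨A, hAF, rfl⟩, hcard⟩ := mem_traceOfCard.1 hB
    exact mem_powersetCard.2 ⟨inter_subset_right, hcard⟩
  have hmeet : ∀ B ∈ traceOfCard F Y (i + 1), ∀ A ∈ F, (B ∩ A).Nonempty := by
    intro B hB A hA
    obtain ⟨⟨B, hBF, rfl⟩, -⟩ := mem_traceOfCard.1 hB
    rw [inter_right_comm]
    exact hFY B hBF A hA
  have hint : ∀ B ∈ traceOfCard F Y (i + 1), ∀ C ∈ traceOfCard F Y (i + 1),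
      (B ∩ C).Nonempty := by
    intro B hB C hC
    obtain ⟨⟨B, hBF, rfl⟩, -⟩ := mem_traceOfCard.1 hB
    obtain ⟨⟨C, hCF, rfl⟩, -⟩ := mem_traceOfCard.1 hC
    rw [← inter_inter_distrib_right]
    exact hFY B hBF C hCF
  by_cases htriv : ∃ p, ∀ B ∈ traceOfCard F Y (i + 1), p ∈ B
  · obtain ⟨p, hp⟩ := htriv
    obtain ⟨C, hC, hpC⟩ := hF.exists_notMem p
    exact card_add_choose_le_of_star hY (by omega) hsub hp hpC
      (mem_powersetCard.1 (hF.subset_powersetCard hC)).2.le fun B hB => hmeet B hB C hC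
  · push Not at htriv
    have hi : 1 ≤ i := by
      by_contra hi
      obtain rfl : i = 0 := by omega
      obtain ⟨y, -⟩ : Y.Nonempty := card_pos.1 (by omega)
      obtain ⟨B, hB, -⟩ := htriv y
      obtain ⟨p, rfl⟩ := card_eq_one.1 (mem_traceOfCard.1 hB).2
      obtain ⟨C, hC, hpC⟩ := htriv p
      obtain ⟨z, hz⟩ := hint _ hB _ hC
      rw [mem_inter, mem_singleton] at hz
      exact hpC (hz.1 ▸ hz.2)
    have h := ih _ hi ⟨hsub, hint, htriv⟩
    have hlt : (k - 1).choose i + 1 ≤ (2 * k - (i + 1) - 1).choose i := by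
      obtain ⟨j, rfl⟩ : ∃ j, i = j + 1 := ⟨i - 1, by omega⟩
      obtain ⟨m, rfl⟩ : ∃ m, k = m + 1 := ⟨k - 1, by omega⟩
      calc (m + 1 - 1).choose (j + 1) + 1 ≤ m.choose (j + 1) + m.choose j := by
            have := Nat.choose_pos (n := m) (k := j) (by omega)
            simp only [Nat.add_sub_cancel]
            omega
        _ = (m + 1).choose (j + 1) := by rw [Nat.choose_succ_succ', add_comm]
        _ ≤ _ := Nat.choose_le_choose _ (by omega)
    omega

lemma sum_range_choose_mul_choose (a b r : ℕ) :
    ∑ i ∈ range (r + 1), a.choose i * b.choose (r - i) = (a + b).choose r := by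
  rw [Nat.add_choose_eq,
    Nat.sum_antidiagonal_eq_sum_range_succ (fun i j => a.choose i * b.choose j)]

/-- The Hilton–Milner bound for families whose members pairwise intersect inside a set of size
`2 * k`, given the bound for smaller uniformities. -/
lemma card_add_choose_le_of_inter_inter_nonempty {X Y : Finset α} {k : ℕ}
    {F : Finset (Finset α)} (hk : 2 ≤ k) (hX : 2 * k < #X) (hF : IsNontrivialIntersecting X k F)
    (hYX : Y ⊆ X) (hY : #Y = 2 * k) (hFY : ∀ A ∈ F, ∀ B ∈ F, (A ∩ B ∩ Y).Nonempty)
    (ih : ∀ i, 2 ≤ i → i < k → ∀ G, IsNontrivialIntersecting Y i G →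
      #G + (2 * k - i - 1).choose (i - 1) ≤ (2 * k - 1).choose (i - 1) + 1) :
    #F + (#X - k - 1).choose (k - 1) ≤ (#X - 1).choose (k - 1) + 1 := by
  obtain ⟨r, rfl⟩ : ∃ r, k = r + 1 := ⟨k - 1, by omega⟩
  obtain ⟨d, hd⟩ : ∃ d, #X = 2 * (r + 1) + d := ⟨#X - 2 * (r + 1), by omega⟩
  have hzero : traceOfCard F Y 0 = ∅ := by
    rw [eq_empty_iff_forall_notMem]
    intro B hB
    obtain ⟨⟨A, hAF, rfl⟩, hcard⟩ := mem_traceOfCard.1 hB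
    have := hFY A hAF A hAF
    rw [inter_self, card_eq_zero.1 hcard] at this
    exact not_nonempty_empty this
  have hlow : ∀ i ∈ range r,
      #(traceOfCard F Y (i + 1)) + r.choose i ≤ (2 * r + 1).choose i := by
    intro i hi
    rw [mem_range] at hi
    have := card_traceOfCard_add_choose_le hF hY (i := i) (by omega) hFY fun G hi1 hG => by
      simpa using ih (i + 1) (by omega) (by omega) G hG
    rwa [show r + 1 - 1 = r by omega, show 2 * (r + 1) - 1 = 2 * r + 1 by omega] at this
  have htop : #(traceOfCard F Y (r + 1)) ≤ (2 * r + 1).choose r := by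
    have h := two_mul_card_le_of_intersecting hY (F := traceOfCard F Y (r + 1))
      (fun B hB => by
        obtain ⟨⟨A, hAF, rfl⟩, hcard⟩ := mem_traceOfCard.1 hB
        exact mem_powersetCard.2 ⟨inter_subset_right, hcard⟩)
      (fun B hB C hC => by
        obtain ⟨⟨B, hBF, rfl⟩, -⟩ := mem_traceOfCard.1 hB
        obtain ⟨⟨C, hCF, rfl⟩, -⟩ := mem_traceOfCard.1 hC
        rw [← inter_inter_distrib_right]
        exact hFY B hBF C hCF)
    rw [show 2 * (r + 1) = 2 * r + 1 + 1 by omega, Nat.choose_succ_succ',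
      Nat.choose_symm_half] at h
    omega
  have hcount := card_le_sum_card_traceOfCard hF.subset_powersetCard hYX
  rw [sum_range_succ', hzero, card_empty, zero_mul, add_zero, hY, hd, Nat.add_sub_cancel_left,
    sum_range_succ, Nat.sub_self, Nat.choose_zero_right, mul_one] at hcount
  simp only [Nat.add_sub_add_right] at hcount
  have hv₁ := sum_range_choose_mul_choose r d r
  have hv₂ := sum_range_choose_mul_choose (2 * r + 1) d r
  rw [sum_range_succ, Nat.sub_self, Nat.choose_zero_right, mul_one] at hv₁ hv₂
  rw [Nat.choose_self] at hv₁
  have hsum : ∑ i ∈ range r, #(traceOfCard F Y (i + 1)) * d.choose (r - i) +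
      ∑ i ∈ range r, r.choose i * d.choose (r - i) ≤
      ∑ i ∈ range r, (2 * r + 1).choose i * d.choose (r - i) := by
    rw [← sum_add_distrib]
    refine sum_le_sum fun i hi => ?_
    rw [← add_mul]
    exact Nat.mul_le_mul_right _ (hlow i hi)
  rw [hd, show 2 * (r + 1) + d - (r + 1) - 1 = r + d by omega,
    show 2 * (r + 1) + d - 1 = 2 * r + 1 + d by omega, Nat.add_sub_cancel]
  omega

/-- If all members of a non-trivial intersecting family meet a pair `T ⊆ Y`, there is one at least
as large whose members pairwise intersect inside `Y`. -/
lemma exists_stable_of_meets_pair {X Y T : Finset α} {k : ℕ} {F : Finset (Finset α)}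
    (hk : 2 ≤ k) (hX : k < #X) (hF : IsNontrivialIntersecting X k F)
    (hT : #T = 2) (hTY : T ⊆ Y) (hYX : Y ⊆ X) (hY : #Y = 2 * k)
    (hFT : ∀ A ∈ F, (A ∩ T).Nonempty) :
    ∃ G, IsNontrivialIntersecting X k G ∧ #F ≤ #G ∧ ∀ A ∈ G, ∀ B ∈ G, (A ∩ B ∩ Y).Nonempty := by
  set S := (X.powersetCard k).filter (T ⊆ ·)
  let P : Finset (Finset α) → Prop := fun G =>
    IsNontrivialIntersecting X k G ∧ (∀ A ∈ G, (A ∩ T).Nonempty) ∧ S ⊆ G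
  have hTne : T.Nonempty := card_pos.1 (by omega)
  have hST : ∀ A ∈ S, T ⊆ A := fun A hA => (mem_filter.1 hA).2
  have hstart : P (F ∪ S) := by
    refine ⟨⟨union_subset hF.subset_powersetCard (filter_subset _ _), ?_, fun p => ?_⟩, ?_,
      subset_union_right⟩
    · intro A hA B hB
      rcases mem_union.1 hA with hA | hA <;> rcases mem_union.1 hB with hB | hB
      · exact hF.inter_nonempty A hA B hB
      · exact (hFT A hA).mono (inter_subset_inter le_rfl (hST B hB))
      · rw [inter_comm]
        exact (hFT B hB).mono (inter_subset_inter le_rfl (hST A hA))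
      · exact hTne.mono (subset_inter (hST A hA) (hST B hB))
    · obtain ⟨A, hA, hp⟩ := hF.exists_notMem p
      exact ⟨A, mem_union_left _ hA, hp⟩
    · intro A hA
      rcases mem_union.1 hA with hA | hA
      · exact hFT A hA
      · rw [inter_eq_right.2 (hST A hA)]
        exact hTne
  have hpres : ∀ G, P G → ∀ a ∈ Y \ T, ∀ b ∈ X \ Y, P (UV.compression {a} {b} G) := by
    rintro G ⟨hG, hGT, hSG⟩ a ha b hb
    rw [mem_sdiff] at ha hb
    have haX := hYX ha.1
    have hbT : b ∉ T := fun h => hb.2 (hTY h)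
    have hab : a ≠ b := fun h => hb.2 (h ▸ ha.1)
    have htrace : ∀ A, UV.compress {a} {b} A ∩ T = A ∩ T := by
      intro A
      rw [compress_singleton]
      split_ifs
      · ext z
        simp only [mem_inter, mem_sdiff, mem_union, mem_singleton]
        grind
      · rfl
    have hsub := compression_subset_powersetCard (b := b) haX hG.subset_powersetCard
    have hS' : S ⊆ UV.compression {a} {b} G := by
      intro A hA
      rw [UV.mem_compression]
      refine Or.inl ⟨hSG hA, hSG (mem_filter.2 ⟨?_, ?_⟩)⟩
      · exact hsub (UV.compress_mem_compression (hSG hA))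
      · rw [← inter_eq_right, htrace, inter_eq_right]
        exact hST A hA
    refine ⟨⟨hsub, compression_inter_nonempty hab hG.inter_nonempty, fun p => ?_⟩, ?_, hS'⟩
    · by_cases hp : p ∈ T
      · obtain ⟨A, hA, hpA⟩ := hG.exists_notMem p
        refine ⟨_, UV.compress_mem_compression hA, fun h => hpA ?_⟩
        exact mem_of_mem_inter_left (htrace A ▸ mem_inter.2 ⟨h, hp⟩)
      · obtain ⟨A, hTA, hAX, hA⟩ := exists_subsuperset_card_eq (n := k)
          (subset_erase.2 ⟨hTY.trans hYX, hp⟩) (by omega)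
          (by have := pred_card_le_card_erase (s := X) (a := p); omega)
        refine ⟨A, hS' (mem_filter.2 ⟨mem_powersetCard.2 ⟨hAX.trans (erase_subset _ _), hA⟩, hTA⟩),
          fun h => notMem_erase p X (hAX h)⟩
    · intro A hA
      rw [UV.mem_compression] at hA
      rcases hA with ⟨hA, -⟩ | ⟨-, B, hB, rfl⟩
      · exact hGT A hA
      · rw [htrace]
        exact hGT B hB
  obtain ⟨G, hG, hcard, hst⟩ := exists_compression_stable P Y _ hstart
  refine ⟨G, hG.1, hcard ▸ card_le_card subset_union_left, ?_⟩
  refine inter_inter_nonempty_of_stable hG.1.subset_powersetCard hG.1.inter_nonempty hY hTY ?_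
    fun a ha b hb => hst a (mem_sdiff.1 ha).1 b (mem_sdiff.1 hb).2 (hpres G hG a ha b hb)
  intro A hA B hB hAB
  have hdisj : Disjoint (A ∩ T) (B ∩ T) := by
    rw [disjoint_iff_inter_eq_empty, ← inter_inter_distrib_right, hAB]
  have h1 := card_pos.2 (hG.2.1 A hA)
  have h2 := card_pos.2 (hG.2.1 B hB)
  have hsub : A ∩ T ∪ B ∩ T ⊆ T := union_subset inter_subset_right inter_subset_right
  have heq := eq_of_subset_of_card_le hsub (by rw [card_union_of_disjoint hdisj]; omega)
  rw [← union_inter_distrib_right] at heq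
  exact inter_eq_right.1 heq

/-- A non-trivial intersecting family can be replaced by one at least as large whose members
pairwise intersect inside a set of size `2 * k`. -/
lemma IsNontrivialIntersecting.exists_inter_inter_nonempty {X : Finset α} {k : ℕ}
    {F : Finset (Finset α)} (hF : IsNontrivialIntersecting X k F) (hk : 2 ≤ k)
    (hX : 2 * k < #X) :
    ∃ Y ⊆ X, #Y = 2 * k ∧ ∃ G, IsNontrivialIntersecting X k G ∧ #F ≤ #G ∧
      ∀ A ∈ G, ∀ B ∈ G, (A ∩ B ∩ Y).Nonempty := by
  obtain ⟨Y, hYX, hY⟩ := exists_subset_card_eq hX.le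
  obtain ⟨G, hG, hcard, hst⟩ := exists_compression_stable (IsNontrivialIntersecting X k) Y F hF
  by_cases hall : ∀ a ∈ Y, ∀ b ∈ X \ Y,
      IsNontrivialIntersecting X k (UV.compression {a} {b} G)
  · refine ⟨Y, hYX, hY, G, hG, hcard.ge, ?_⟩
    exact inter_inter_nonempty_of_stable (T := ∅) hG.subset_powersetCard hG.inter_nonempty hY
      (empty_subset _) (fun _ _ _ _ _ => empty_subset _) fun a ha b hb =>
        hst a (mem_sdiff.1 ha).1 b (mem_sdiff.1 hb).2 (hall a (mem_sdiff.1 ha).1 b hb)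
  · push Not at hall
    obtain ⟨a, ha, b, hb, hnot⟩ := hall
    rw [mem_sdiff] at hb
    have hab : a ≠ b := fun h => hb.2 (h ▸ ha)
    obtain ⟨p, hp⟩ : ∃ p, ∀ A ∈ UV.compression {a} {b} G, p ∈ A := by
      by_contra! h
      exact hnot ⟨compression_subset_powersetCard (hYX ha) hG.subset_powersetCard,
        compression_inter_nonempty hab hG.inter_nonempty, h⟩
    have hmeet : ∀ A ∈ G, (A ∩ {a, b}).Nonempty := by
      have hpa : p = a := by
        obtain ⟨A, hA, hpA⟩ := hG.exists_notMem p
        have h := hp _ (UV.compress_mem_compression hA)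
        rw [compress_singleton] at h
        split_ifs at h
        · simp only [mem_sdiff, mem_union, mem_singleton] at h
          tauto
        · exact absurd h hpA
      subst hpa
      intro A hA
      have h := hp _ (UV.compress_mem_compression hA)
      rw [compress_singleton] at h
      split_ifs at h with hc
      · exact ⟨b, by simp [hc.2]⟩
      · exact ⟨p, by simp [h]⟩
    have hTX : {a, b} ⊆ X := by
      simp [insert_subset_iff, hYX ha, hb.1]
    have hT : #({a, b} : Finset α) = 2 := card_pair hab
    obtain ⟨Z, hTZ, hZX, hZ⟩ := exists_subsuperset_card_eq hTX (n := 2 * k) (by omega) hX.le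
    obtain ⟨H, hH, hGH, hHZ⟩ :=
      exists_stable_of_meets_pair hk (by omega) hG hT hTZ hZX hZ hmeet
    exact ⟨Z, hZX, hZ, H, hH, hcard.ge.trans hGH, hHZ⟩

/-- The **Hilton–Milner theorem**, in additive form. -/
theorem IsNontrivialIntersecting.card_add_choose_le {X : Finset α} {k : ℕ}
    {F : Finset (Finset α)} (hF : IsNontrivialIntersecting X k F) (hk : 2 ≤ k)
    (hX : 2 * k < #X) :
    #F + (#X - k - 1).choose (k - 1) ≤ (#X - 1).choose (k - 1) + 1 := by
  induction k using Nat.strong_induction_on generalizing X F with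
  | _ k ih =>
    obtain ⟨Y, hYX, hY, G, hG, hFG, hGY⟩ := hF.exists_inter_inter_nonempty hk hX
    have := card_add_choose_le_of_inter_inter_nonempty hk hX hG hYX hY hGY
      fun i hi hik H hH => hY ▸ ih i hik hH hi (by omega)
    omega

end IntersectingFamilies

theorem HiltonMilner (n k : ℕ) (hk : 2 ≤ k) (hn : 2 * k < n)
    (F : Finset (Finset ℕ))
    (hF : ∀ A ∈ F, A ∈ (Finset.Icc 1 n).powersetCard k)
    (hint : ∀ A ∈ F, ∀ B ∈ F, (A ∩ B).Nonempty)
    (hnontriv : ¬ ∃ p, ∀ A ∈ F, p ∈ A) :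
    F.card ≤ (n - 1).choose (k - 1) - (n - k - 1).choose (k - 1) + 1 := by
  push Not at hnontriv
  have h := IsNontrivialIntersecting.card_add_choose_le (X := Icc 1 n) ⟨hF, hint, hnontriv⟩ hk
    (by simpa using hn)
  rw [Nat.card_Icc, Nat.add_sub_cancel] at h
  have hle : (n - k - 1).choose (k - 1) ≤ (n - 1).choose (k - 1) :=
    Nat.choose_le_choose _ (by omega)
  omega
end

section
/- Let t ≥ 4, k ≥ t+2, n > ((5+√5)k − 7)/2, and let F ⊆ ([n] choose k) be a non-trivial intersecting family with F ⊄ M_{k,t₀−1} for every 2 ≤ t₀ ≤ t. Then |F| ≤ C(n-1,k-1) − Σ_{j=1}^{t} C(n-k-j, k-j) + t. -/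
open Finset

/-- The family `M_{k,j}` on ground set `[n] = {1,…,n}`. -/
def familyMkj (n k j : ℕ) : Finset (Finset ℕ) :=
  ((Finset.Icc 1 n).powersetCard k).filter
    (fun F => (1 ∈ F ∧ (F ∩ Finset.Icc 2 k).Nonempty) ∨
              (1 ∈ F ∧ F ∩ Finset.Icc 2 k = ∅ ∧ Finset.Icc (k + 1) (k + j) ⊆ F) ∨
              (1 ∉ F ∧ Finset.Icc 2 k ⊆ F ∧ (F ∩ Finset.Icc (k + 1) (k + j)).card = 1))

open scoped FinsetFamily in
/-- A two-term cascade form of the Kruskal–Katona theorem, for cross-intersecting families. -/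
theorem card_add_le_of_cross_intersecting_fin {N r a x y : ℕ} {𝒜 ℬ : Finset (Finset (Fin N))}
    (h𝒜 : ∀ A ∈ 𝒜, #A = a + 1) (hℬ : ∀ B ∈ ℬ, #B + (r + 1) = N)
    (hcross : ∀ A ∈ 𝒜, ∀ B ∈ ℬ, (A ∩ B).Nonempty)
    (har : a ≤ r) (hry : r ≤ y) (hrx : r + 1 ≤ x) (hyx : y ≤ x) (hxN : x < N)
    (hcard : x.choose (r + 1) + y.choose r ≤ #ℬ) :
    #𝒜 + (x.choose (a + 1) + y.choose a) ≤ N.choose (a + 1) := by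
  classical
  let X : Fin N := ⟨x, hxN⟩
  let Y : Fin N := ⟨y, by omega⟩
  have hXY : ∀ i ∈ Iio Y, i < X := fun i hi => by
    have := Finset.mem_Iio.1 hi
    simp only [Fin.lt_def, X, Y] at *
    omega
  let seg : ℕ → Finset (Finset (Fin N)) := fun c =>
    powersetCard (c + 1) (Iio X) ∪ (powersetCard c (Iio Y)).image (insert X)
  have hX_notMem : ∀ {c : ℕ} {S : Finset (Fin N)}, S ∈ powersetCard c (Iio Y) → X ∉ S := by
    intro c S hS hXS
    exact lt_irrefl _ (hXY X ((mem_powersetCard.1 hS).1 hXS))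
  have hseg_card : ∀ c, #(seg c) = x.choose (c + 1) + y.choose c := by
    intro c
    rw [card_union_of_disjoint, card_powersetCard, card_image_of_injOn, card_powersetCard,
      Fin.card_Iio, Fin.card_Iio]
    · intro S hS T hT hST
      have := congrArg (fun U => U.erase X) hST
      simpa [erase_insert (hX_notMem hS), erase_insert (hX_notMem hT)] using this
    · rw [Finset.disjoint_left]
      intro S hS hS'
      obtain ⟨T, -, rfl⟩ := mem_image.1 hS'
      have := (mem_powersetCard.1 hS).1 (mem_insert_self X T)
      simp at this
  have hseg_sized : ∀ c, ∀ S ∈ seg c, #S = c + 1 := by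
    intro c S hS
    rcases mem_union.1 hS with h | h
    · exact (mem_powersetCard.1 h).2
    · obtain ⟨T, hT, rfl⟩ := mem_image.1 h
      rw [card_insert_of_notMem (hX_notMem hT), (mem_powersetCard.1 hT).2]
  have hseg_init : Colex.IsInitSeg (seg r) (r + 1) := by
    refine ⟨fun S hS => hseg_sized r S hS, ?_⟩
    rintro S T hS ⟨hTS, hT⟩
    rcases mem_union.1 hS with h | h
    · refine mem_union_left _ (mem_powersetCard.2 ⟨fun i hi => ?_, hT⟩)
      exact Finset.mem_Iio.2 (Colex.forall_lt_mono hTS.le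
        (fun b hb => Finset.mem_Iio.1 ((mem_powersetCard.1 h).1 hb)) i hi)
    · obtain ⟨U, hU, rfl⟩ := mem_image.1 h
      have hle : ∀ b ∈ T, b ≤ X := Colex.forall_le_mono hTS.le (by
        intro b hb
        rcases mem_insert.1 hb with rfl | hb
        · exact le_rfl
        · exact (hXY b ((mem_powersetCard.1 hU).1 hb)).le)
      by_cases hXT : X ∈ T
      · refine mem_union_right _ (mem_image.2 ⟨T.erase X, ?_, insert_erase hXT⟩)
        have hlt : toColex (T.erase X) < toColex U := by
          have hXU := mem_insert_self X U
          have := (Colex.toColex_sdiff_lt_toColex_sdiff (singleton_subset_iff.2 hXT)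
            (singleton_subset_iff.2 hXU)).2 hTS
          rwa [sdiff_singleton_eq_erase, sdiff_singleton_eq_erase,
            erase_insert (hX_notMem hU)] at this
        refine mem_powersetCard.2 ⟨fun i hi => ?_, by rw [card_erase_of_mem hXT, hT]; rfl⟩
        exact Finset.mem_Iio.2 (Colex.forall_lt_mono hlt.le
          (fun b hb => Finset.mem_Iio.1 ((mem_powersetCard.1 hU).1 hb)) i hi)
      · refine mem_union_left _ (mem_powersetCard.2 ⟨fun i hi => ?_, hT⟩)
        exact Finset.mem_Iio.2 (lt_of_le_of_ne (hle i hi) (fun h => hXT (h ▸ hi)))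
  have hseg_shadow : seg a ⊆ ∂^[r - a] (seg r) := by
    intro S hS
    rw [mem_shadow_iterate_iff_exists_mem_card_add]
    have hScard := hseg_sized a S hS
    rcases mem_union.1 hS with h | h
    · obtain ⟨T, hST, hTX, hTc⟩ := exists_subsuperset_card_eq (mem_powersetCard.1 h).1
        (n := r + 1) (by omega) (by rw [Fin.card_Iio]; exact hrx)
      exact ⟨T, mem_union_left _ (mem_powersetCard.2 ⟨hTX, hTc⟩), hST, by omega⟩
    · obtain ⟨U, hU, rfl⟩ := mem_image.1 h
      obtain ⟨hUY, hUc⟩ := mem_powersetCard.1 hU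
      obtain ⟨T, hUT, hTY, hTc⟩ := exists_subsuperset_card_eq hUY (n := r) (by omega)
        (by rw [Fin.card_Iio]; exact hry)
      have hT : T ∈ powersetCard r (Iio Y) := mem_powersetCard.2 ⟨hTY, hTc⟩
      refine ⟨insert X T, mem_union_right _ (mem_image_of_mem _ hT), insert_subset_insert X hUT, ?_⟩
      rw [hScard, card_insert_of_notMem (hX_notMem hT), hTc]
      omega
  have hcompl : #(ℬ.image compl) = #ℬ := card_image_of_injective _ compl_injective
  have hkk := iterated_kk (k := r - a) (𝒜 := ℬ.image compl) (𝒞 := seg r) (r := r + 1) ?_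
    (by rw [hcompl, hseg_card]; exact hcard) hseg_init
  · have hdisj : Disjoint 𝒜 (∂^[r - a] (ℬ.image compl)) := by
      rw [Finset.disjoint_left]
      intro A hA hA'
      obtain ⟨C, hC, hAC, -⟩ := mem_shadow_iterate_iff_exists_mem_card_add.1 hA'
      obtain ⟨B, hB, rfl⟩ := mem_image.1 hC
      obtain ⟨z, hz⟩ := hcross A hA B hB
      rw [mem_inter] at hz
      exact (mem_compl.1 (hAC hz.1)) hz.2
    have hsub : 𝒜 ∪ ∂^[r - a] (ℬ.image compl) ⊆ powersetCard (a + 1) univ := by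
      intro S hS
      refine mem_powersetCard.2 ⟨subset_univ _, ?_⟩
      rcases mem_union.1 hS with h | h
      · exact h𝒜 S h
      · obtain ⟨C, hC, -, hc⟩ := mem_shadow_iterate_iff_exists_mem_card_add.1 h
        obtain ⟨B, hB, rfl⟩ := mem_image.1 hC
        have := hℬ B hB
        rw [card_compl, Fintype.card_fin] at hc
        omega
    have h1 := card_le_card hsub
    rw [card_union_of_disjoint hdisj, card_powersetCard, card_univ, Fintype.card_fin] at h1
    have h2 := card_le_card hseg_shadow
    rw [hseg_card] at h2
    omega
  · intro C hC
    obtain ⟨B, hB, rfl⟩ := mem_image.1 hC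
    have := hℬ B hB
    rw [card_compl, Fintype.card_fin]
    omega

/-- A two-term cascade form of the Kruskal–Katona theorem, for cross-intersecting families of
subsets of a finite set `V`. -/
theorem card_add_le_of_cross_intersecting {α : Type*} [DecidableEq α] {V : Finset α}
    {r a x y : ℕ} {𝒜 ℬ : Finset (Finset α)}
    (h𝒜V : ∀ A ∈ 𝒜, A ⊆ V) (hℬV : ∀ B ∈ ℬ, B ⊆ V)
    (h𝒜 : ∀ A ∈ 𝒜, #A = a + 1) (hℬ : ∀ B ∈ ℬ, #B + (r + 1) = #V)
    (hcross : ∀ A ∈ 𝒜, ∀ B ∈ ℬ, (A ∩ B).Nonempty)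
    (har : a ≤ r) (hry : r ≤ y) (hrx : r + 1 ≤ x) (hyx : y ≤ x) (hxN : x < #V)
    (hcard : x.choose (r + 1) + y.choose r ≤ #ℬ) :
    #𝒜 + (x.choose (a + 1) + y.choose a) ≤ (#V).choose (a + 1) := by
  classical
  let e := V.equivFin
  let φ : Finset α → Finset (Fin #V) := fun S => univ.filter fun i => (e.symm i : α) ∈ S
  have hmap : ∀ S ⊆ V, (φ S).map (e.symm.toEmbedding.trans (Function.Embedding.subtype _)) = S := by
    intro S hS
    ext z
    simp only [mem_map, φ, mem_filter, mem_univ, true_and, Function.Embedding.trans_apply,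
      Equiv.coe_toEmbedding, Function.Embedding.subtype_apply]
    constructor
    · rintro ⟨i, hi, rfl⟩
      exact hi
    · intro hz
      exact ⟨e ⟨z, hS hz⟩, by simpa using hz, by simp⟩
  have hφcard : ∀ S ⊆ V, #(φ S) = #S := by
    intro S hS
    conv_rhs => rw [← hmap S hS]
    rw [card_map]
  have hinj : ∀ 𝒮 : Finset (Finset α), (∀ S ∈ 𝒮, S ⊆ V) → #(𝒮.image φ) = #𝒮 := by
    intro 𝒮 h𝒮
    refine card_image_of_injOn fun S hS T hT hST => ?_
    rw [← hmap S (h𝒮 S hS), ← hmap T (h𝒮 T hT)]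
    rw [hST]
  have := card_add_le_of_cross_intersecting_fin (𝒜 := 𝒜.image φ) (ℬ := ℬ.image φ) (N := #V)
    (r := r) (a := a) (x := x) (y := y) ?_ ?_ ?_ har hry hrx hyx hxN ?_
  · rwa [hinj 𝒜 h𝒜V] at this
  · simp only [forall_mem_image]
    intro A hA
    rw [hφcard A (h𝒜V A hA), h𝒜 A hA]
  · simp only [forall_mem_image]
    intro B hB
    rw [hφcard B (hℬV B hB), hℬ B hB]
  · simp only [forall_mem_image]
    intro A hA B hB
    obtain ⟨z, hz⟩ := hcross A hA B hB
    rw [mem_inter] at hz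
    exact ⟨e ⟨z, h𝒜V A hA hz.1⟩, by simp [φ, hz.1, hz.2]⟩
  · rwa [hinj ℬ hℬV]

theorem choose_ratio_bounds {c s : ℕ} (h : 13 * c + 2 ≤ 5 * s) :
    13 * (c + s + 3).choose c ≤ 10 * (c + s + 1).choose (c + 1) ∧
    17 * (c + s + 3).choose c ≤ 10 * (c + s + 2).choose (c + 1) ∧
    (c + s + 5).choose c ≤ 2 * (c + s + 3).choose c := by
  have e1 : (c + s + 2).choose (c + 1) * (s + 1) = (c + s + 1).choose (c + 1) * (c + s + 2) := by
    have := Nat.choose_mul_succ_eq (c + s + 1) (c + 1)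
    rw [show c + s + 1 + 1 - (c + 1) = s + 1 by omega] at this
    exact this.symm
  have e2 : (c + s + 3).choose (c + 1) * (s + 2) = (c + s + 2).choose (c + 1) * (c + s + 3) := by
    have := Nat.choose_mul_succ_eq (c + s + 2) (c + 1)
    rw [show c + s + 2 + 1 - (c + 1) = s + 2 by omega] at this
    exact this.symm
  have e3 : (c + s + 3).choose (c + 1) * (c + 1) = (c + s + 3).choose c * (s + 3) := by
    have := Nat.choose_succ_right_eq (c + s + 3) c
    rwa [show c + s + 3 - c = s + 3 by omega] at this
  have e4 : (c + s + 4).choose c * (s + 4) = (c + s + 3).choose c * (c + s + 4) := by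
    have := Nat.choose_mul_succ_eq (c + s + 3) c
    rw [show c + s + 3 + 1 - c = s + 4 by omega] at this
    exact this.symm
  have e5 : (c + s + 5).choose c * (s + 5) = (c + s + 4).choose c * (c + s + 5) := by
    have := Nat.choose_mul_succ_eq (c + s + 4) c
    rw [show c + s + 4 + 1 - c = s + 5 by omega] at this
    exact this.symm
  generalize (c + s + 1).choose (c + 1) = X at *
  generalize (c + s + 2).choose (c + 1) = W at *
  generalize (c + s + 3).choose (c + 1) = U at *
  generalize (c + s + 3).choose c = Y at *
  generalize (c + s + 4).choose c = T at *
  generalize (c + s + 5).choose c = Z at *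
  have f1 : Y * ((s + 2) * (s + 3)) = W * ((c + 1) * (c + s + 3)) := by
    calc Y * ((s + 2) * (s + 3)) = (Y * (s + 3)) * (s + 2) := by ring
      _ = (U * (s + 2)) * (c + 1) := by rw [← e3]; ring
      _ = _ := by rw [e2]; ring
  have f2 : Y * ((s + 1) * (s + 2) * (s + 3)) = X * ((c + 1) * (c + s + 2) * (c + s + 3)) := by
    calc Y * ((s + 1) * (s + 2) * (s + 3)) = (Y * ((s + 2) * (s + 3))) * (s + 1) := by ring
      _ = (W * (s + 1)) * ((c + 1) * (c + s + 3)) := by rw [f1]; ring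
      _ = _ := by rw [e1]; ring
  have f3 : Z * ((s + 4) * (s + 5)) = Y * ((c + s + 4) * (c + s + 5)) := by
    calc Z * ((s + 4) * (s + 5)) = (Z * (s + 5)) * (s + 4) := by ring
      _ = (T * (s + 4)) * (c + s + 5) := by rw [e5]; ring
      _ = _ := by rw [e4]; ring
  have b1 : 13 * (c + 1) ≤ 5 * s + 11 := by omega
  have b2 : 13 * (c + s + 2) ≤ 18 * s + 24 := by omega
  have b3 : 13 * (c + s + 3) ≤ 18 * s + 37 := by omega
  have b4 : 13 * (c + s + 4) ≤ 18 * s + 50 := by omega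
  have b5 : 13 * (c + s + 5) ≤ 18 * s + 63 := by omega
  have key : ∀ {u v p q D P : ℕ}, 0 < D → v * D = u * P → p * P ≤ q * D → p * v ≤ q * u := by
    intro u v p q D P hD hvu hPD
    refine Nat.le_of_mul_le_mul_right (c := D) ?_ hD
    calc p * v * D = u * (p * P) := by rw [mul_assoc, hvu]; ring
      _ ≤ u * (q * D) := Nat.mul_le_mul_left u hPD
      _ = q * u * D := by ring
  refine ⟨key (by positivity) f2 ?_, key (by positivity) f1 ?_, ?_⟩
  · have h1 := Nat.mul_le_mul (Nat.mul_le_mul b1 b2) b3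
    have h2 : (5 * s + 11) * (18 * s + 24) * (18 * s + 37) ≤
        1690 * ((s + 1) * (s + 2) * (s + 3)) := by
      ring_nf
      nlinarith [Nat.zero_le (s ^ 3), Nat.zero_le (s ^ 2)]
    have h3 : 13 * (c + 1) * (13 * (c + s + 2)) * (13 * (c + s + 3)) =
        2197 * ((c + 1) * (c + s + 2) * (c + s + 3)) := by ring
    omega
  · have h1 := Nat.mul_le_mul b1 b3
    have h2 : 17 * ((5 * s + 11) * (18 * s + 37)) ≤ 1690 * ((s + 2) * (s + 3)) := by
      ring_nf
      nlinarith [Nat.zero_le (s ^ 2)]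
    have h3 : 13 * (c + 1) * (13 * (c + s + 3)) = 169 * ((c + 1) * (c + s + 3)) := by ring
    omega
  · have := key (p := 1) (q := 2) (by positivity) f3 (by
      have h1 := Nat.mul_le_mul b4 b5
      have h2 : (18 * s + 50) * (18 * s + 63) ≤ 338 * ((s + 4) * (s + 5)) := by
        ring_nf
        nlinarith [Nat.zero_le (s ^ 2)]
      have h3 : 13 * (c + s + 4) * (13 * (c + s + 5)) = 169 * ((c + s + 4) * (c + s + 5)) := by
        ring
      omega)
    omega

theorem choose_two_le_choose {r a : ℕ} (hr : 11 ≤ r) (ha : 4 ≤ a) (har : 2 * a ≤ r) :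
    (r + 3).choose 2 ≤ r.choose a := by
  have h3 : ∀ r, 11 ≤ r → r + 3 ≤ r.choose 3 := by
    intro r hr
    induction r, hr using Nat.le_induction with
    | base => decide
    | succ r hr ih =>
      have : r.choose 2 ≥ 1 := Nat.choose_pos (by omega)
      have e : (r + 1).choose 3 = r.choose 2 + r.choose 3 := Nat.choose_succ_succ r 2
      omega
  have h4 : ∀ r, 11 ≤ r → (r + 3).choose 2 ≤ r.choose 4 := by
    intro r hr
    induction r, hr using Nat.le_induction with
    | base => decide
    | succ r hr ih =>
      have e1 : (r + 1 + 3).choose 2 = (r + 3) + (r + 3).choose 2 := by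
        rw [show r + 1 + 3 = (r + 3) + 1 by ring, Nat.choose_succ_succ, Nat.choose_one_right]
      have e2 : (r + 1).choose 4 = r.choose 3 + r.choose 4 := Nat.choose_succ_succ r 3
      have := h3 r hr
      omega
  refine (h4 r hr).trans ?_
  induction a, ha using Nat.le_induction with
  | base => exact le_rfl
  | succ a ha ih =>
    exact (ih (by omega)).trans (Nat.choose_le_succ_of_lt_half_left (by omega))

section Estimates

variable {r a : ℕ}

theorem choose_ratio_bounds' (ha : 4 ≤ a) (h : 13 * a ≤ 5 * r + 1) :
    13 * (a + r).choose (r + 1) ≤ 10 * (a + r - 2).choose a ∧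
    17 * (a + r).choose (r + 1) ≤ 10 * (a + r - 1).choose a ∧
    (a + r + 2).choose (r + 3) ≤ 2 * (a + r).choose (r + 1) := by
  obtain ⟨c, rfl⟩ : ∃ c, a = c + 1 := ⟨a - 1, by omega⟩
  obtain ⟨s, rfl⟩ : ∃ s, r = s + 2 := ⟨r - 2, by omega⟩
  have := choose_ratio_bounds (c := c) (s := s) (by omega)
  rw [show c + 1 + (s + 2) - 2 = c + s + 1 by omega, show c + 1 + (s + 2) - 1 = c + s + 2 by omega,
    show c + 1 + (s + 2) = c + s + 3 by omega, show c + s + 3 + 2 = c + s + 5 by omega,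
    Nat.choose_symm_of_eq_add (show c + s + 3 = s + 2 + 1 + c by omega),
    Nat.choose_symm_of_eq_add (show c + s + 5 = s + 2 + 3 + c by omega)]
  exact this

theorem choose_add_two_le_choose (ha : 4 ≤ a) (h : 13 * a ≤ 5 * r + 1) {x : ℕ}
    (hrx : r ≤ x) (hx : x + 2 ≤ a + r) : (x + 2).choose (r + 1) ≤ x.choose a := by
  refine Nat.decreasingInduction' (P := fun x => r ≤ x → (x + 2).choose (r + 1) ≤ x.choose a)
    (m := x) (n := a + r - 2) ?_ (by omega) ?_ hrx
  · intro x hx _ ih hrx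
    have ih := ih (by omega)
    have e1 := Nat.choose_mul_succ_eq (x + 2) (r + 1)
    have e2 := Nat.choose_mul_succ_eq x a
    refine Nat.le_of_mul_le_mul_right (c := x + 2 + 1) ?_ (by omega)
    calc (x + 2).choose (r + 1) * (x + 2 + 1)
        = (x + 1 + 2).choose (r + 1) * (x + 2 + 1 - (r + 1)) := e1
      _ ≤ (x + 1).choose a * (x + 1 - a) := Nat.mul_le_mul ih (by omega)
      _ = x.choose a * (x + 1) := e2.symm
      _ ≤ x.choose a * (x + 2 + 1) := Nat.mul_le_mul_left _ (by omega)
  · intro _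
    have := (choose_ratio_bounds' ha h).1
    rw [show a + r - 2 + 2 = a + r by omega]
    omega

theorem choose_loss (ha : 4 ≤ a) (h : 13 * a ≤ 5 * r + 1) :
    (a + r).choose (r + 1) + (a + r - 1).choose r + (r + 2).choose (a + 1) ≤
      (a + r).choose (a + 1) := by
  have h1 := choose_add_two_le_choose ha h (x := a + r - 2) (by omega) (by omega)
  obtain ⟨m, hm⟩ : ∃ m, a + r = m + 2 := ⟨a + r - 2, by omega⟩
  simp only [hm, Nat.add_sub_cancel, show m + 2 - 1 = m + 1 by omega] at h1 ⊢
  have e1 : (m + 2).choose (a + 1) = (m + 1).choose a + (m + 1).choose (a + 1) :=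
    Nat.choose_succ_succ _ _
  have e2 : (m + 1).choose (a + 1) = m.choose a + m.choose (a + 1) := Nat.choose_succ_succ _ _
  have e3 : (m + 2).choose (r + 1) = (m + 1).choose r + (m + 1).choose (r + 1) :=
    Nat.choose_succ_succ _ _
  have i1 : (r + 2).choose (a + 1) ≤ m.choose (a + 1) := Nat.choose_le_choose _ (by omega)
  have i2 : m.choose a ≤ (m + 1).choose a := Nat.choose_le_choose _ (by omega)
  omega

theorem choose_loss_shifted (ha : 4 ≤ a) (h : 13 * a ≤ 5 * r + 1) :
    (a + r + 1).choose (r + 1) + (a + r + 2).choose (r + 3) + (r + 2).choose (a + 1) ≤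
      (a + r + 1).choose (a + 1) := by
  obtain ⟨h1, h2, h3⟩ := choose_ratio_bounds' ha h
  obtain ⟨m, hm⟩ : ∃ m, a + r = m + 2 := ⟨a + r - 2, by omega⟩
  simp only [hm, Nat.add_sub_cancel, show m + 2 - 1 = m + 1 by omega] at h1 h2 h3 ⊢
  have e0 : (m + 2 + 1).choose (a + 1) = (m + 2).choose a + (m + 2).choose (a + 1) :=
    Nat.choose_succ_succ _ _
  have e1 : (m + 2).choose (a + 1) = (m + 1).choose a + (m + 1).choose (a + 1) :=
    Nat.choose_succ_succ _ _
  have e2 : (m + 1).choose (a + 1) = m.choose a + m.choose (a + 1) := Nat.choose_succ_succ _ _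
  have e3 : (m + 2 + 1).choose (r + 1) = (m + 2).choose r + (m + 2).choose (r + 1) :=
    Nat.choose_succ_succ _ _
  have e4 : (m + 2).choose r = (m + 2).choose a := Nat.choose_symm_of_eq_add (by omega)
  have i1 : (r + 2).choose (a + 1) ≤ m.choose (a + 1) := Nat.choose_le_choose _ (by omega)
  omega

/-- The numerical input for applying `card_add_le_of_cross_intersecting` to a family of size `q`. -/
theorem exists_cascade (ha : 4 ≤ a) (h : 13 * a ≤ 5 * r + 1) {q : ℕ}
    (hq : r + 3 ≤ q) (hq' : q ≤ (a + r + 1).choose (r + 1)) :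
    ∃ x y, r ≤ y ∧ r + 1 ≤ x ∧ y ≤ x ∧ x ≤ a + r ∧ x.choose (r + 1) + y.choose r ≤ q ∧
      q + (r + 2).choose (a + 1) ≤ x.choose (a + 1) + y.choose a := by
  have pascal : ∀ x j : ℕ, x.choose (j + 1) + x.choose j = (x + 1).choose (j + 1) := fun x j => by
    rw [Nat.choose_succ_succ, add_comm]
  rcases le_or_gt q ((r + 3).choose 2) with h1 | h1
  · refine ⟨r + 2, r, le_rfl, by omega, by omega, by omega, ?_, ?_⟩
    · rw [Nat.choose_succ_self_right, Nat.choose_self]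
      omega
    · have := choose_two_le_choose (r := r) (a := a) (by omega) ha (by omega)
      omega
  rcases lt_or_ge q ((a + r).choose (r + 1)) with h2 | h2
  · have key : ∀ w, r + 3 ≤ w → w ≤ a + r → q < w.choose (r + 1) →
        ∃ x, r + 2 ≤ x ∧ x + 2 ≤ a + r ∧ (x + 1).choose (r + 1) ≤ q ∧
          q < (x + 2).choose (r + 1) := by
      intro w hw
      induction w, hw using Nat.le_induction with
      | base =>
        intro _ hlt
        rw [Nat.choose_symm_of_eq_add (show r + 3 = r + 1 + 2 by omega)] at hlt
        omega
      | succ w hw ih =>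
        intro hwa hlt
        rcases lt_or_ge q (w.choose (r + 1)) with hc | hc
        · exact ih (by omega) hc
        · exact ⟨w - 1, by omega, by omega, by rwa [show w - 1 + 1 = w by omega],
            by rwa [show w - 1 + 2 = w + 1 by omega]⟩
    obtain ⟨x, hx1, hx2, hx3, hx4⟩ := key (a + r) (by omega) le_rfl h2
    refine ⟨x, x, by omega, by omega, le_rfl, by omega, by rwa [pascal], ?_⟩
    have i1 := choose_add_two_le_choose ha h (x := x) (by omega) hx2
    have i2 : (r + 2).choose (a + 1) ≤ x.choose (a + 1) := Nat.choose_le_choose _ hx1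
    omega
  have h3 := choose_loss ha h
  obtain ⟨m, hm⟩ : ∃ m, a + r = m + 1 := ⟨a + r - 1, by omega⟩
  simp only [hm, Nat.add_sub_cancel] at h2 h3 hq' ⊢
  rcases le_or_gt q ((m + 1).choose (r + 1) + m.choose r) with h4 | h4
  · refine ⟨m, m, by omega, by omega, le_rfl, by omega, by rwa [pascal], ?_⟩
    rw [pascal]
    omega
  · refine ⟨m + 1, m, by omega, by omega, by omega, le_rfl, h4.le, ?_⟩
    have e1 : (m + 1 + 1).choose (r + 1) = (m + 1).choose r + (m + 1).choose (r + 1) :=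
      Nat.choose_succ_succ _ _
    have e2 : (m + 1).choose r = (m + 1).choose a := Nat.choose_symm_of_eq_add (by omega)
    obtain ⟨c, rfl⟩ : ∃ c, a = c + 1 := ⟨a - 1, by omega⟩
    have e3 : (m + 1).choose (c + 1) = m.choose c + m.choose (c + 1) := Nat.choose_succ_succ _ _
    have e4 : m.choose c = m.choose r := Nat.choose_symm_of_eq_add (by omega)
    omega

end Estimates

section Structure

variable {α : Type*} [DecidableEq α] {V : Finset α} {r a : ℕ} {𝒜 ℬ : Finset (Finset α)}

theorem card_powersetCard_sdiff {Z : Finset α} (hZ : Z ⊆ V) {c d m : ℕ} (hV : #V = m + c)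
    (hZc : #Z = c) : #(powersetCard d (V \ Z)) = m.choose d := by
  rw [card_powersetCard, card_sdiff_of_subset hZ, hV, hZc, Nat.add_sub_cancel]

theorem card_image_insert_powersetCard {w : α} {S : Finset α} (hw : w ∉ S) (d : ℕ) :
    #((powersetCard d S).image (insert w)) = (#S).choose d := by
  rw [card_image_of_injOn, card_powersetCard]
  intro A hA B hB hAB
  have hA' : w ∉ A := fun h => hw ((mem_powersetCard.1 hA).1 h)
  have hB' : w ∉ B := fun h => hw ((mem_powersetCard.1 hB).1 h)
  have := congrArg (fun U => U.erase w) hAB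
  simpa [erase_insert hA', erase_insert hB'] using this

theorem card_sdiff_erase {Z : Finset α} (hZ : Z ⊆ V) {w : α} (hwV : w ∈ V) (hwZ : w ∉ Z)
    {c m : ℕ} (hV : #V = m + 1 + c) (hZc : #Z = c) : #((V \ Z).erase w) = m := by
  rw [card_erase_of_mem (mem_sdiff.2 ⟨hwV, hwZ⟩), card_sdiff_of_subset hZ]
  omega

theorem card_add_add_add_le {β : Type*} [DecidableEq β] {𝒮 𝒟₀ 𝒟₁ 𝒟₂ 𝒟₃ : Finset β}
    (h₀ : 𝒟₀ ⊆ 𝒮) (h₁ : 𝒟₁ ⊆ 𝒮) (h₂ : 𝒟₂ ⊆ 𝒮) (h₃ : 𝒟₃ ⊆ 𝒮)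
    (h₀₁ : Disjoint 𝒟₀ 𝒟₁) (h₀₂ : Disjoint 𝒟₀ 𝒟₂) (h₀₃ : Disjoint 𝒟₀ 𝒟₃)
    (h₁₂ : Disjoint 𝒟₁ 𝒟₂) (h₁₃ : Disjoint 𝒟₁ 𝒟₃) (h₂₃ : Disjoint 𝒟₂ 𝒟₃) :
    #𝒟₀ + #𝒟₁ + #𝒟₂ + #𝒟₃ ≤ #𝒮 := by
  rw [← card_union_of_disjoint h₀₁, ← card_union_of_disjoint (disjoint_union_left.2 ⟨h₀₂, h₁₂⟩),
    ← card_union_of_disjoint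
      (disjoint_union_left.2 ⟨disjoint_union_left.2 ⟨h₀₃, h₁₃⟩, h₂₃⟩)]
  exact card_le_card (union_subset (union_subset (union_subset h₀ h₁) h₂) h₃)

theorem disjoint_of_avoid (hcross : ∀ A ∈ 𝒜, ∀ B ∈ ℬ, (A ∩ B).Nonempty) {B : Finset α}
    (hB : B ∈ ℬ) {𝒟 : Finset (Finset α)} (h𝒟 : ∀ D ∈ 𝒟, Disjoint D B) : Disjoint 𝒜 𝒟 := by
  rw [Finset.disjoint_left]
  intro A hA hA'
  exact (hcross A hA B hB).ne_empty (disjoint_iff_inter_eq_empty.1 (h𝒟 A hA'))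

theorem mem_image_insert_powersetCard {w : α} {S D : Finset α} {d : ℕ} (hw : w ∉ S)
    (hD : D ∈ (powersetCard d S).image (insert w)) : w ∈ D ∧ D ⊆ insert w S ∧ #D = d + 1 := by
  obtain ⟨E, hE, rfl⟩ := mem_image.1 hD
  obtain ⟨hES, hE⟩ := mem_powersetCard.1 hE
  exact ⟨mem_insert_self w E, insert_subset_insert w hES,
    by rw [card_insert_of_notMem (fun h => hw (hES h)), hE]⟩

theorem card_add_le_of_three_sets
    (hV : #V = a + r + 3) (h𝒜 : ∀ A ∈ 𝒜, A ∈ powersetCard (a + 1) V)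
    (hℬ : ∀ B ∈ ℬ, B ∈ powersetCard (a + 2) V)
    (hcross : ∀ A ∈ 𝒜, ∀ B ∈ ℬ, (A ∩ B).Nonempty)
    {A B C : Finset α} (hA : A ∈ ℬ) (hB : B ∈ ℬ) (hC : C ∈ ℬ)
    {w z : α} (hwA : w ∈ A) (hwB : w ∉ B) (hzA : z ∈ A) (hzB : z ∈ B) (hzC : z ∉ C) :
    #𝒜 + (r + 1).choose (a + 1) + r.choose a + r.choose a ≤ (a + r + 3).choose (a + 1) := by
  obtain ⟨hAV, hAc⟩ := mem_powersetCard.1 (hℬ A hA)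
  obtain ⟨hBV, hBc⟩ := mem_powersetCard.1 (hℬ B hB)
  obtain ⟨hCV, hCc⟩ := mem_powersetCard.1 (hℬ C hC)
  have c₁ := card_powersetCard_sdiff (d := a + 1) hAV (show #V = r + 1 + (a + 2) by omega) hAc
  have c₂ := card_image_insert_powersetCard (notMem_erase w (V \ B)) a
  rw [card_sdiff_erase hBV (hAV hwA) hwB (show #V = r + 1 + (a + 2) by omega) hBc] at c₂
  have c₃ := card_image_insert_powersetCard (notMem_erase z (V \ C)) a
  rw [card_sdiff_erase hCV (hAV hzA) hzC (show #V = r + 1 + (a + 2) by omega) hCc] at c₃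
  rw [← hV, ← card_powersetCard, ← c₁]
  conv_lhs => enter [1, 2]; rw [← c₂]
  conv_lhs => enter [2]; rw [← c₃]
  have m₁ : ∀ D ∈ powersetCard (a + 1) (V \ A), Disjoint D A := fun D hD =>
    disjoint_of_subset_left (mem_powersetCard.1 hD).1 sdiff_disjoint
  have m₂ := fun D => mem_image_insert_powersetCard (D := D) (d := a) (notMem_erase w (V \ B))
  have m₃ := fun D => mem_image_insert_powersetCard (D := D) (d := a) (notMem_erase z (V \ C))
  rw [insert_erase (mem_sdiff.2 ⟨hAV hwA, hwB⟩)] at m₂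
  rw [insert_erase (mem_sdiff.2 ⟨hAV hzA, hzC⟩)] at m₃
  refine card_add_add_add_le h𝒜 (powersetCard_mono sdiff_subset)
    (fun D hD => mem_powersetCard.2 ⟨(m₂ D hD).2.1.trans sdiff_subset, (m₂ D hD).2.2⟩)
    (fun D hD => mem_powersetCard.2 ⟨(m₃ D hD).2.1.trans sdiff_subset, (m₃ D hD).2.2⟩)
    (disjoint_of_avoid hcross hA m₁)
    (disjoint_of_avoid hcross hB fun D hD => disjoint_of_subset_left (m₂ D hD).2.1 sdiff_disjoint)
    (disjoint_of_avoid hcross hC fun D hD => disjoint_of_subset_left (m₃ D hD).2.1 sdiff_disjoint)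
    ?_ ?_ ?_
  · exact Finset.disjoint_left.2 fun D h1 h2 =>
      Finset.disjoint_left.1 (m₁ D h1) (m₂ D h2).1 hwA
  · exact Finset.disjoint_left.2 fun D h1 h2 =>
      Finset.disjoint_left.1 (m₁ D h1) (m₃ D h2).1 hzA
  · exact Finset.disjoint_left.2 fun D h1 h2 =>
      (mem_sdiff.1 ((m₂ D h1).2.1 (m₃ D h2).1)).2 hzB

theorem card_add_le_of_two_sets
    (hV : #V = a + r + 3) (h𝒜 : ∀ A ∈ 𝒜, A ∈ powersetCard (a + 1) V)
    (hℬ : ∀ B ∈ ℬ, B ∈ powersetCard (a + 2) V)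
    (hcross : ∀ A ∈ 𝒜, ∀ B ∈ ℬ, (A ∩ B).Nonempty)
    {A B : Finset α} (hA : A ∈ ℬ) (hB : B ∈ ℬ) (hr : 1 ≤ r)
    {w z : α} (hwA : w ∈ A) (hwB : w ∉ B) (hzA : z ∈ A) (hzB : z ∉ B) (hwz : w ≠ z) :
    #𝒜 + (r + 1).choose (a + 1) + r.choose a + (r - 1).choose a ≤
      (a + r + 3).choose (a + 1) := by
  obtain ⟨hAV, hAc⟩ := mem_powersetCard.1 (hℬ A hA)
  obtain ⟨hBV, hBc⟩ := mem_powersetCard.1 (hℬ B hB)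
  have hwBV : insert w B ⊆ V := insert_subset (hAV hwA) hBV
  have hwBc : #(insert w B) = a + 3 := by rw [card_insert_of_notMem hwB, hBc]
  have hzwB : z ∉ insert w B := by simp [hwz.symm, hzB]
  have c₁ := card_powersetCard_sdiff (d := a + 1) hAV (show #V = r + 1 + (a + 2) by omega) hAc
  have c₂ := card_image_insert_powersetCard (notMem_erase w (V \ B)) a
  rw [card_sdiff_erase hBV (hAV hwA) hwB (show #V = r + 1 + (a + 2) by omega) hBc] at c₂
  have c₃ := card_image_insert_powersetCard (notMem_erase z (V \ insert w B)) a
  rw [card_sdiff_erase hwBV (hAV hzA) hzwB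
    (show #V = r - 1 + 1 + (a + 3) by omega) hwBc] at c₃
  rw [← hV, ← card_powersetCard, ← c₁, ← c₂, ← c₃]
  have m₁ : ∀ D ∈ powersetCard (a + 1) (V \ A), Disjoint D A := fun D hD =>
    disjoint_of_subset_left (mem_powersetCard.1 hD).1 sdiff_disjoint
  have m₂ := fun D => mem_image_insert_powersetCard (D := D) (d := a) (notMem_erase w (V \ B))
  have m₃ := fun D => mem_image_insert_powersetCard (D := D) (d := a)
    (notMem_erase z (V \ insert w B))
  rw [insert_erase (mem_sdiff.2 ⟨hAV hwA, hwB⟩)] at m₂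
  rw [insert_erase (mem_sdiff.2 ⟨hAV hzA, hzwB⟩)] at m₃
  refine card_add_add_add_le h𝒜 (powersetCard_mono sdiff_subset)
    (fun D hD => mem_powersetCard.2 ⟨(m₂ D hD).2.1.trans sdiff_subset, (m₂ D hD).2.2⟩)
    (fun D hD => mem_powersetCard.2 ⟨(m₃ D hD).2.1.trans sdiff_subset, (m₃ D hD).2.2⟩)
    (disjoint_of_avoid hcross hA m₁)
    (disjoint_of_avoid hcross hB fun D hD => disjoint_of_subset_left (m₂ D hD).2.1 sdiff_disjoint)
    (disjoint_of_avoid hcross hB fun D hD => disjoint_of_subset_left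
      ((m₃ D hD).2.1.trans (sdiff_subset_sdiff le_rfl (subset_insert w B))) sdiff_disjoint)
    ?_ ?_ ?_
  · exact Finset.disjoint_left.2 fun D h1 h2 =>
      Finset.disjoint_left.1 (m₁ D h1) (m₂ D h2).1 hwA
  · exact Finset.disjoint_left.2 fun D h1 h2 =>
      Finset.disjoint_left.1 (m₁ D h1) (m₃ D h2).1 hzA
  · exact Finset.disjoint_left.2 fun D h1 h2 =>
      (mem_sdiff.1 ((m₃ D h2).2.1 (m₂ D h1).1)).2 (mem_insert_self w B)

/-- Either the members of `ℬ` have `a + 1` points in common, or `𝒜` is small. -/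
theorem exists_kernel_or_card_add_le
    (hV : #V = a + r + 3) (h𝒜 : ∀ A ∈ 𝒜, A ∈ powersetCard (a + 1) V)
    (hℬ : ∀ B ∈ ℬ, B ∈ powersetCard (a + 2) V)
    (hcross : ∀ A ∈ 𝒜, ∀ B ∈ ℬ, (A ∩ B).Nonempty)
    (hne : ℬ.Nonempty) (ha : 1 ≤ a) (hr : 1 ≤ r)
    (hnum : r.choose (a - 1) ≤ (r - 1).choose a) :
    (∃ K ⊆ V, #K = a + 1 ∧ ∀ B ∈ ℬ, K ⊆ B) ∨
      #𝒜 + (r + 2).choose (a + 1) ≤ (a + r + 3).choose (a + 1) := by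
  have e1 : (r + 2).choose (a + 1) = (r + 1).choose a + (r + 1).choose (a + 1) :=
    Nat.choose_succ_succ _ _
  have e2 : (r + 1).choose a = r.choose (a - 1) + r.choose a := by
    obtain ⟨c, rfl⟩ : ∃ c, a = c + 1 := ⟨a - 1, by omega⟩
    exact Nat.choose_succ_succ _ _
  have e3 : (r - 1).choose a ≤ r.choose a := Nat.choose_le_choose _ (by omega)
  obtain ⟨A, hA⟩ := hne
  obtain ⟨hAV, hAc⟩ := mem_powersetCard.1 (hℬ A hA)
  by_cases hone : ∀ B ∈ ℬ, B = A
  · obtain ⟨K, hKA, hK⟩ := exists_subset_card_eq (show a + 1 ≤ #A by omega)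
    exact Or.inl ⟨K, hKA.trans hAV, hK, fun B hB => by rwa [hone B hB]⟩
  push Not at hone
  obtain ⟨B, hB, hBA⟩ := hone
  obtain ⟨hBV, hBc⟩ := mem_powersetCard.1 (hℬ B hB)
  obtain ⟨w, hwA, hwB⟩ : ∃ w ∈ A, w ∉ B := by
    by_contra! hcon
    exact hBA (eq_of_subset_of_card_le hcon (by omega)).symm
  by_cases hker : ∀ C ∈ ℬ, A ∩ B ⊆ C
  · by_cases hcard : #(A ∩ B) = a + 1
    · exact Or.inl ⟨A ∩ B, inter_subset_left.trans hAV, hcard, hker⟩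
    · right
      have h1 := card_sdiff_add_card_inter A B
      have h2 : #(A ∩ B) < a + 2 := by
        rw [← hAc]
        exact card_lt_card ⟨inter_subset_left, fun h => hwB (mem_inter.1 (h hwA)).2⟩
      obtain ⟨u, hu, v, hv, huv⟩ := one_lt_card.1 (show 1 < #(A \ B) by omega)
      rw [mem_sdiff] at hu hv
      have := card_add_le_of_two_sets hV h𝒜 hℬ hcross hA hB hr hu.1 hu.2 hv.1 hv.2 huv
      omega
  · right
    push Not at hker
    obtain ⟨C, hC, hsub⟩ := hker
    obtain ⟨z, hz, hzC⟩ := not_subset.1 hsub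
    rw [mem_inter] at hz
    have := card_add_le_of_three_sets hV h𝒜 hℬ hcross hA hB hC hwA hwB hz.1 hz.2 hzC
    omega

theorem card_filter_superset {W Y : Finset α} (hY : Y ⊆ W) (d : ℕ) :
    #((powersetCard d W).filter (Y ⊆ ·)) ≤ if #Y ≤ d then (#W - #Y).choose (d - #Y) else 0 := by
  split_ifs with h
  · rw [← card_sdiff_of_subset hY, ← card_powersetCard]
    refine card_le_card_of_injOn (· \ Y) ?_ ?_
    · intro D hD
      simp only [coe_filter, mem_powersetCard, Set.mem_ofPred_eq] at hD
      exact mem_coe.2 (mem_powersetCard.2 ⟨sdiff_subset_sdiff hD.1.1 le_rfl,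
        by rw [card_sdiff_of_subset hD.2, hD.1.2]⟩)
    · intro D hD E hE hDE
      simp only [coe_filter, mem_powersetCard, Set.mem_ofPred_eq] at hD hE
      rw [← sdiff_union_of_subset hD.2, ← sdiff_union_of_subset hE.2]
      simp only at hDE
      rw [hDE]
  · rw [Nat.le_zero, card_eq_zero, filter_eq_empty_iff]
    intro D hD hYD
    have := card_le_card hYD
    rw [(mem_powersetCard.1 hD).2] at this
    exact h this

variable {K : Finset α}

/-- A family of `(a + 2)`-sets with `a + 1` points in common is given by their other points. -/
theorem exists_eq_image_insert (hV : #V = a + r + 3)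
    (hℬ : ∀ B ∈ ℬ, B ∈ powersetCard (a + 2) V)
    (hKV : K ⊆ V) (hK : #K = a + 1) (hKℬ : ∀ B ∈ ℬ, K ⊆ B) :
    ∃ Y ⊆ V \ K, #(V \ K) = r + 2 ∧ #ℬ = #Y ∧ ℬ = Y.image (insert · K) := by
  refine ⟨(V \ K).filter (fun y => insert y K ∈ ℬ), filter_subset _ _, ?_, ?_⟩
  · rw [card_sdiff_of_subset hKV]; omega
  set Y := (V \ K).filter (fun y => insert y K ∈ ℬ) with hY
  have hYK : ∀ y ∈ Y, y ∉ K := fun y hy => (mem_sdiff.1 (mem_filter.1 hy).1).2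
  have hℬY : ℬ = Y.image (insert · K) := by
    ext B
    simp only [mem_image]
    constructor
    · intro hB
      obtain ⟨hBV, hBc⟩ := mem_powersetCard.1 (hℬ B hB)
      have h1 : #(B \ K) = 1 := by rw [card_sdiff_of_subset (hKℬ B hB)]; omega
      obtain ⟨y, hy⟩ := card_eq_one.1 h1
      have h2 : insert y K = B := by
        rw [insert_eq, ← hy, sdiff_union_of_subset (hKℬ B hB)]
      have h3 : y ∈ B \ K := hy ▸ mem_singleton_self y
      rw [mem_sdiff] at h3
      exact ⟨y, mem_filter.2 ⟨mem_sdiff.2 ⟨hBV h3.1, h3.2⟩, h2 ▸ hB⟩, h2⟩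
    · rintro ⟨y, hy, rfl⟩
      exact (mem_filter.1 hy).2
  refine ⟨?_, hℬY⟩
  rw [hℬY, card_image_of_injOn]
  intro y hy z hz hyz
  have : y ∈ insert z K := by
    have h : insert y K = insert z K := hyz
    exact h ▸ mem_insert_self y K
  exact (mem_insert.1 this).resolve_right (hYK y hy)

/-- The size of `𝒜` when the members of `ℬ` have `a + 1` points in common. -/
theorem card_add_le_of_kernel
    (hV : #V = a + r + 3) (h𝒜 : ∀ A ∈ 𝒜, A ∈ powersetCard (a + 1) V)
    (hℬ : ∀ B ∈ ℬ, B ∈ powersetCard (a + 2) V)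
    (hcross : ∀ A ∈ 𝒜, ∀ B ∈ ℬ, (A ∩ B).Nonempty)
    (hKV : K ⊆ V) (hK : #K = a + 1)
    (hKℬ : ∀ B ∈ ℬ, K ⊆ B) :
    #ℬ ≤ r + 2 ∧ #𝒜 + (r + 2).choose (a + 1) ≤ (a + r + 3).choose (a + 1) +
      if #ℬ ≤ a + 1 then (r + 2 - #ℬ).choose (a + 1 - #ℬ) else 0 := by
  obtain ⟨Y, hYW, hWc, hcard, hℬY⟩ := exists_eq_image_insert hV hℬ hKV hK hKℬ
  set W := V \ K
  refine ⟨by rw [hcard, ← hWc]; exact card_le_card hYW, ?_⟩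
  have hsup := card_filter_superset hYW (a + 1)
  rw [hWc, ← hcard] at hsup
  refine le_trans ?_ (Nat.add_le_add_left hsup _)
  have hdisj : Disjoint 𝒜 ((powersetCard (a + 1) W).filter (fun D => ¬ Y ⊆ D)) := by
    rw [Finset.disjoint_left]
    intro D hD hD'
    rw [mem_filter, mem_powersetCard] at hD'
    obtain ⟨y, hy, hyD⟩ := not_subset.1 hD'.2
    obtain ⟨z, hz⟩ := hcross D hD (insert y K) (hℬY ▸ mem_image_of_mem _ hy)
    rw [mem_inter, mem_insert] at hz
    rcases hz.2 with rfl | hzK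
    · exact hyD hz.1
    · exact (mem_sdiff.1 (hD'.1.1 hz.1)).2 hzK
  have hsub : 𝒜 ∪ (powersetCard (a + 1) W).filter (fun D => ¬ Y ⊆ D) ⊆ powersetCard (a + 1) V :=
    union_subset h𝒜 ((filter_subset _ _).trans (powersetCard_mono sdiff_subset))
  have h1 := card_le_card hsub
  rw [card_union_of_disjoint hdisj, card_powersetCard, hV] at h1
  have h2 := card_filter_add_card_filter_not (s := powersetCard (a + 1) W) (fun D => Y ⊆ D)
  rw [card_powersetCard, hWc] at h2
  omega

end Structure

section Numerics

theorem nat_bounds_of_sqrt_lt {a r : ℕ} (ha : 4 ≤ a)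
    (h : ((5 + Real.sqrt 5) * (a + 2 : ℕ) - 7) / 2 < ((a + r + 4 : ℕ) : ℝ)) :
    13 * a ≤ 5 * r + 1 ∧ r * a ≤ (r - a) * (r - a + 1) := by
  have h5 : Real.sqrt 5 ^ 2 = 5 := Real.sq_sqrt (by norm_num)
  have hs0 : (0 : ℝ) ≤ Real.sqrt 5 := Real.sqrt_nonneg 5
  have hlow : (2.2 : ℝ) < Real.sqrt 5 := by
    rw [Real.lt_sqrt (by norm_num)]; norm_num
  have hupp : Real.sqrt 5 < 2.25 := by
    rw [Real.sqrt_lt' (by norm_num)]; norm_num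
  push_cast at h
  have ha' : (4 : ℝ) ≤ a := by exact_mod_cast ha
  have h1 : 13 * a ≤ 5 * r + 1 := by
    have : (26 * a : ℝ) < 10 * r + 3 := by nlinarith
    have : 26 * a < 10 * r + 3 := by exact_mod_cast this
    omega
  refine ⟨h1, ?_⟩
  obtain ⟨d, rfl⟩ : ∃ d, r = a + d := ⟨r - a, by omega⟩
  rw [Nat.add_sub_cancel_left]
  push_cast at h
  have hX : Real.sqrt 5 * (a + 2) < 2 * d - a + 5 := by linarith
  set S := Real.sqrt 5 * (a + 2) with hS
  have hS2 : S ^ 2 = 5 * (a + 2) ^ 2 := by rw [hS, mul_pow, h5]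
  have hS4 : 4 ≤ S := by nlinarith
  have hS5 : S ≤ 2.25 * (a + 2) := by nlinarith
  have : ((a + d) * a : ℝ) ≤ d * (d + 1) := by
    have := mul_nonneg (sub_nonneg.2 hX.le) (show 0 ≤ (2 * d - a + 5 : ℝ) + S - 8 by linarith)
    nlinarith
  exact_mod_cast this

theorem choose_pred_le_choose_of_mul_le {a r : ℕ} (ha : 1 ≤ a) (har : a < r)
    (h : r * a ≤ (r - a) * (r - a + 1)) : r.choose (a - 1) ≤ (r - 1).choose a := by
  obtain ⟨c, rfl⟩ : ∃ c, a = c + 1 := ⟨a - 1, by omega⟩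
  obtain ⟨d, rfl⟩ : ∃ d, r = c + 1 + d := ⟨r - (c + 1), by omega⟩
  rw [Nat.add_sub_cancel_left] at h
  have e : c + 1 + d - 1 = c + d := by omega
  rw [Nat.add_sub_cancel, e]
  have h1 := Nat.choose_mul_succ_eq (c + d) c
  have h2 := Nat.choose_succ_right_eq (c + d) c
  rw [show c + d + 1 - c = d + 1 by omega, show c + d + 1 = c + 1 + d by omega] at h1
  rw [Nat.add_sub_cancel_left] at h2
  have hpos : 0 < (c + 1) * (d + 1) := by positivity
  refine Nat.le_of_mul_le_mul_left ?_ hpos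
  calc (c + 1) * (d + 1) * (c + 1 + d).choose c
      = (c + d).choose c * ((c + 1 + d) * (c + 1)) := by linear_combination (c + 1) * h1.symm
    _ ≤ (c + d).choose c * (d * (d + 1)) := Nat.mul_le_mul_left _ h
    _ = _ := by linear_combination (d + 1) * h2.symm

theorem sum_choose_sub_add (a r : ℕ) {t : ℕ} (hta : t ≤ a) (har : a ≤ r) :
    ∑ j ∈ Icc 1 t, (r + 2 - j).choose (a + 2 - j) + (r + 2 - t).choose (a + 1 - t) =
      (r + 2).choose (a + 1) := by
  induction t with
  | zero => simp
  | succ t ih =>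
    rw [sum_Icc_succ_top (by omega), ← ih (by omega)]
    obtain ⟨u, hu⟩ : ∃ u, r + 2 - t = u + 1 := ⟨r + 1 - t, by omega⟩
    obtain ⟨v, hv⟩ : ∃ v, a + 1 - t = v + 1 := ⟨a - t, by omega⟩
    rw [hu, hv, show r + 2 - (t + 1) = u by omega, show a + 2 - (t + 1) = v + 1 by omega,
      show a + 1 - (t + 1) = v by omega, Nat.choose_succ_succ' u v]
    omega

theorem choose_sub_add_antitone {a r s t : ℕ} (har : a ≤ r) (hst : s ≤ t) (hta : t ≤ a + 1) :
    (r + 2 - t).choose (a + 1 - t) + t ≤ (r + 2 - s).choose (a + 1 - s) + s := by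
  induction t, hst using Nat.le_induction with
  | base => rfl
  | succ t hst ih =>
    refine le_trans ?_ (ih (by omega))
    obtain ⟨u, hu⟩ : ∃ u, r + 2 - t = u + 1 := ⟨r + 1 - t, by omega⟩
    obtain ⟨v, hv⟩ : ∃ v, a + 1 - t = v + 1 := ⟨a - t, by omega⟩
    rw [hu, hv, show r + 2 - (t + 1) = u by omega, show a + 1 - (t + 1) = v by omega,
      Nat.choose_succ_succ' u v]
    have := Nat.choose_pos (show v + 1 ≤ u by omega)
    omega

end Numerics

section Relabelling

theorem exists_perm_of_card_fiber_eq {α β : Type*} [DecidableEq α] [DecidableEq β] {S : Finset α}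
    {f g : α → β} (h : ∀ c, #(S.filter (f · = c)) = #(S.filter (g · = c))) :
    ∃ σ : Equiv.Perm α, S.image σ = S ∧ ∀ x ∈ S, g (σ x) = f x := by
  have e : ∀ c, Nonempty ({x : S // f x = c} ≃ {x : S // g x = c}) := by
    intro c
    refine Fintype.card_eq.1 ?_
    have key : ∀ w : α → β, Fintype.card {x : S // w x = c} = #(S.filter (w · = c)) := by
      intro w
      rw [Fintype.card_subtype, ← card_map (Function.Embedding.subtype (· ∈ S))]
      congr 1
      ext x
      simp [and_comm]
    rw [key, key, h]
  let τ : Equiv.Perm S := (Equiv.sigmaFiberEquiv (fun x : S => f x)).symm.trans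
    ((Equiv.sigmaCongrRight fun c => (e c).some).trans (Equiv.sigmaFiberEquiv (fun x : S => g x)))
  have hτ : ∀ x : S, g (τ x) = f x := fun x => ((e (f x)).some ⟨x, rfl⟩).2
  refine ⟨Equiv.Perm.ofSubtype τ, ?_, ?_⟩
  · refine eq_of_subset_of_card_le (image_subset_iff.2 fun x hx => ?_)
      (card_image_of_injective _ (Equiv.injective _)).ge
    rw [Equiv.Perm.ofSubtype_apply_of_mem τ hx]
    exact (τ _).2
  · intro x hx
    rw [Equiv.Perm.ofSubtype_apply_of_mem τ hx]
    exact hτ ⟨x, hx⟩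

theorem exists_perm_image_eq {α : Type*} [DecidableEq α] {S K Y K' Y' : Finset α} {p p' : α}
    (hp : p ∈ S) (hK : K ⊆ S.erase p) (hY : Y ⊆ S.erase p \ K)
    (hp' : p' ∈ S) (hK' : K' ⊆ S.erase p') (hY' : Y' ⊆ S.erase p' \ K')
    (hKK : #K = #K') (hYY : #Y = #Y') :
    ∃ σ : Equiv.Perm α, S.image σ = S ∧ σ p = p' ∧ K.image σ = K' ∧ Y.image σ = Y' := by
  let c : α → Finset α → Finset α → α → ℕ := fun p K Y x =>
    if x = p then 0 else if x ∈ K then 1 else if x ∈ Y then 2 else 3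
  have c0 : ∀ p K Y x, c p K Y x = 0 ↔ x = p := by
    intro p K Y x; simp only [c]; split_ifs <;> simp_all
  have c1 : ∀ p K Y x, K ⊆ S.erase p → (c p K Y x = 1 ↔ x ∈ K) := by
    intro p K Y x h
    have := fun h' => ne_of_mem_erase (@h x h')
    simp only [c]; split_ifs <;> simp_all
  have c2 : ∀ p K Y x, Y ⊆ S.erase p \ K → (c p K Y x = 2 ↔ x ∈ Y) := by
    intro p K Y x h
    have h1 := fun h' => (mem_sdiff.1 (@h x h')).2
    have h2 := fun h' => ne_of_mem_erase (mem_sdiff.1 (@h x h')).1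
    simp only [c]; split_ifs <;> simp_all
  have c3 : ∀ p K Y x, c p K Y x = 3 ↔ x ∉ insert p (K ∪ Y) := by
    intro p K Y x; simp only [c]; split_ifs <;> simp_all
  have count : ∀ p K Y, p ∈ S → K ⊆ S.erase p → Y ⊆ S.erase p \ K → ∀ i,
      #(S.filter (c p K Y · = i)) =
        if i = 0 then 1 else if i = 1 then #K else if i = 2 then #Y else
        if i = 3 then #S - (1 + #K + #Y) else 0 := by
    intro p K Y hp hK hY i
    have hKS := hK.trans (erase_subset p S)
    have hYS := (hY.trans sdiff_subset).trans (erase_subset p S)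
    split_ifs with h0 h1 h2 h3
    · subst h0
      rw [filter_congr fun x _ => c0 p K Y x, filter_eq', if_pos hp, card_singleton]
    · subst h1
      rw [filter_congr fun x _ => c1 p K Y x hK, filter_mem_eq_inter, inter_eq_right.2 hKS]
    · subst h2
      rw [filter_congr fun x _ => c2 p K Y x hY, filter_mem_eq_inter, inter_eq_right.2 hYS]
    · subst h3
      have hd : Disjoint K Y := (disjoint_of_subset_left hY sdiff_disjoint).symm
      have hpn : p ∉ K ∪ Y := by
        rw [mem_union, not_or]
        exact ⟨fun h => notMem_erase p S (hK h),
          fun h => notMem_erase p S (mem_sdiff.1 (hY h)).1⟩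
      rw [filter_congr fun x _ => c3 p K Y x, filter_notMem_eq_sdiff, card_sdiff_of_subset
        (insert_subset hp (union_subset hKS hYS)), card_insert_of_notMem hpn,
        card_union_of_disjoint hd]
      congr 1
      omega
    · rw [card_eq_zero, filter_eq_empty_iff]
      intro x _ hx
      simp only [c] at hx
      split_ifs at hx <;> omega
  obtain ⟨σ, hσS, hσ⟩ := exists_perm_of_card_fiber_eq (S := S) (f := c p K Y) (g := c p' K' Y')
    (fun i => by rw [count p K Y hp hK hY, count p' K' Y' hp' hK' hY', hKK, hYY])
  refine ⟨σ, hσS, ?_, ?_, ?_⟩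
  · exact (c0 p' K' Y' _).1 ((hσ p hp).trans ((c0 p K Y p).2 rfl))
  · refine eq_of_subset_of_card_le (image_subset_iff.2 fun x hx => ?_)
      (by rw [card_image_of_injective _ σ.injective, hKK])
    exact (c1 p' K' Y' _ hK').1
      ((hσ x (erase_subset p S (hK hx))).trans ((c1 p K Y x hK).2 hx))
  · refine eq_of_subset_of_card_le (image_subset_iff.2 fun x hx => ?_)
      (by rw [card_image_of_injective _ σ.injective, hYY])
    exact (c2 p' K' Y' _ hY').1
      ((hσ x (erase_subset p S (mem_sdiff.1 (hY hx)).1)).trans ((c2 p K Y x hY).2 hx))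

/-- An intersecting family whose members that miss `p` are the sets `insert y K` with `y ∈ Y`
lies in a copy of `familyMkj n k #Y`. -/
theorem exists_perm_image_mem_familyMkj {n k p : ℕ} {F : Finset (Finset ℕ)} {K Y : Finset ℕ}
    (hF : ∀ A ∈ F, A ∈ (Icc 1 n).powersetCard k)
    (hint : ∀ A ∈ F, ∀ B ∈ F, (A ∩ B).Nonempty) (hp : p ∈ Icc 1 n)
    (hK : K ⊆ (Icc 1 n).erase p) (hKc : #K + 1 = k) (hY : Y ⊆ (Icc 1 n).erase p \ K)
    (hFY : F.filter (p ∉ ·) = Y.image (insert · K)) :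
    ∃ σ : Equiv.Perm ℕ, (Icc 1 n).image σ = Icc 1 n ∧ ∀ A ∈ F, A.image σ ∈ familyMkj n k #Y := by
  have hn : 1 + #K + #Y ≤ n := by
    have h1 := card_le_card hY
    rw [card_sdiff_of_subset hK, card_erase_of_mem hp, Nat.card_Icc] at h1
    have h2 := card_le_card hK
    rw [card_erase_of_mem hp, Nat.card_Icc] at h2
    have := (mem_Icc.1 hp)
    omega
  obtain ⟨σ, hσS, hσp, hσK, hσY⟩ := exists_perm_image_eq (K' := Icc 2 k)
    (Y' := Icc (k + 1) (k + #Y)) (p' := 1) hp hK hY (mem_Icc.2 ⟨le_rfl, by omega⟩)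
    (fun x hx => by rw [mem_Icc] at hx; rw [mem_erase, mem_Icc]; omega)
    (fun x hx => by rw [mem_Icc] at hx; rw [mem_sdiff, mem_erase, mem_Icc, mem_Icc]; omega)
    (by rw [Nat.card_Icc]; omega) (by rw [Nat.card_Icc]; omega)
  refine ⟨σ, hσS, fun A hA => ?_⟩
  obtain ⟨hAS, hAc⟩ := mem_powersetCard.1 (hF A hA)
  rw [familyMkj, mem_filter, mem_powersetCard]
  refine ⟨⟨?_, by rw [card_image_of_injective _ σ.injective, hAc]⟩, ?_⟩
  · rw [← hσS]; exact image_subset_image hAS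
  rw [← hσK, ← hσY, ← image_inter _ _ σ.injective, ← image_inter _ _ σ.injective,
    card_image_of_injective _ σ.injective, image_nonempty, image_eq_empty,
    image_subset_image_iff σ.injective, image_subset_image_iff σ.injective, ← hσp,
    σ.injective.mem_finset_image]
  have hYF : ∀ y ∈ Y, insert y K ∈ F := fun y hy =>
    (mem_filter.1 (hFY ▸ mem_image_of_mem (insert · K) hy)).1
  by_cases hpA : p ∈ A
  · by_cases hAK : (A ∩ K).Nonempty
    · exact Or.inl ⟨hpA, hAK⟩
    · rw [not_nonempty_iff_eq_empty] at hAK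
      refine Or.inr (Or.inl ⟨hpA, hAK, fun y hy => ?_⟩)
      obtain ⟨z, hz⟩ := hint A hA _ (hYF y hy)
      rw [mem_inter, mem_insert] at hz
      rcases hz.2 with rfl | hzK
      · exact hz.1
      · exact absurd (mem_inter.2 ⟨hz.1, hzK⟩) (hAK ▸ notMem_empty z)
  · obtain ⟨y, hy, rfl⟩ := mem_image.1 (hFY ▸ mem_filter.2 ⟨hA, hpA⟩)
    refine Or.inr (Or.inr ⟨hpA, subset_insert _ _, ?_⟩)
    have hdisj : K ∩ Y = ∅ :=
      disjoint_iff_inter_eq_empty.1 (disjoint_of_subset_left hY sdiff_disjoint).symm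
    rw [insert_inter_of_mem hy, hdisj, insert_empty, card_singleton, hσp]

end Relabelling

section Links

variable {α : Type*} [DecidableEq α]

theorem exists_link {p : α} {G : Finset (Finset α)} (hp : ∀ A ∈ G, p ∈ A) :
    ∃ 𝒜 : Finset (Finset α), #𝒜 = #G ∧ ∀ D, D ∈ 𝒜 ↔ ∃ A ∈ G, A.erase p = D :=
  ⟨G.image (erase · p), card_image_of_injOn fun A hA B hB h => by
    rw [← insert_erase (hp A hA), ← insert_erase (hp B hB)]
    exact congrArg (insert p) h, fun _ => mem_image⟩

variable {a r : ℕ}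

theorem card_le_of_cross_intersecting {V : Finset α} {𝒜 ℬ : Finset (Finset α)}
    (hV : #V = a + r + 2) (h𝒜 : ∀ A ∈ 𝒜, A ∈ powersetCard (a + 1) V)
    (hℬ : ∀ B ∈ ℬ, B ∈ powersetCard (a + 1) V) (hcross : ∀ A ∈ 𝒜, ∀ B ∈ ℬ, (A ∩ B).Nonempty)
    (ha : 1 ≤ a) (har : a ≤ r) (h : (a + r + 1).choose (r + 1) ≤ #ℬ) :
    #𝒜 ≤ (a + r + 1).choose (r + 1) := by
  have key := card_add_le_of_cross_intersecting (r := r) (a := a) (x := a + r) (y := a + r)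
    (fun A hA => (mem_powersetCard.1 (h𝒜 A hA)).1) (fun B hB => (mem_powersetCard.1 (hℬ B hB)).1)
    (fun A hA => (mem_powersetCard.1 (h𝒜 A hA)).2)
    (fun B hB => by rw [(mem_powersetCard.1 (hℬ B hB)).2, hV]; omega)
    hcross har (by omega) (by omega) le_rfl (by omega)
    (by rw [Nat.choose_succ_succ' (a + r) r] at h; omega)
  rw [hV, Nat.choose_succ_succ' (a + r + 1) a, Nat.choose_succ_succ' (a + r) a] at key
  rw [Nat.choose_symm_of_eq_add (show a + r + 1 = r + 1 + a by omega)]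
  omega

theorem card_add_card_le_of_cross_intersecting {V : Finset α} {𝒜 ℬ : Finset (Finset α)}
    (hV : #V = a + r + 2) (h𝒜 : ∀ A ∈ 𝒜, A ∈ powersetCard (a + 1) V)
    (hℬ : ∀ B ∈ ℬ, B ∈ powersetCard (a + 1) V) (hcross : ∀ A ∈ 𝒜, ∀ B ∈ ℬ, (A ∩ B).Nonempty)
    (ha : 4 ≤ a) (h : 13 * a ≤ 5 * r + 1) (h1 : r + 3 ≤ #ℬ) (h2 : #ℬ ≤ #𝒜) :
    #𝒜 + #ℬ + (r + 2).choose (a + 1) ≤ (a + r + 2).choose (a + 1) := by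
  have h3 : #ℬ ≤ (a + r + 1).choose (r + 1) := by
    by_contra! h4
    have := card_le_of_cross_intersecting hV h𝒜 hℬ hcross (by omega) (by omega) h4.le
    omega
  obtain ⟨x, y, hry, hrx, hyx, hxar, hle, hge⟩ := exists_cascade ha h h1 h3
  have key := card_add_le_of_cross_intersecting (r := r) (a := a) (x := x) (y := y)
    (fun A hA => (mem_powersetCard.1 (h𝒜 A hA)).1) (fun B hB => (mem_powersetCard.1 (hℬ B hB)).1)
    (fun A hA => (mem_powersetCard.1 (h𝒜 A hA)).2)
    (fun B hB => by rw [(mem_powersetCard.1 (hℬ B hB)).2, hV]; omega)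
    hcross (by omega) hry hrx hyx (by omega) hle
  rw [hV] at key
  omega

variable {S : Finset α} {F : Finset (Finset α)}

theorem exists_link_filter (hS : #S = a + r + 4)
    (hF : ∀ A ∈ F, A ∈ powersetCard (a + 2) S) (hint : ∀ A ∈ F, ∀ B ∈ F, (A ∩ B).Nonempty)
    {p : α} (hp : p ∈ S) :
    ∃ 𝒜 : Finset (Finset α), #F = #𝒜 + #(F.filter (p ∉ ·)) ∧ #(S.erase p) = a + r + 3 ∧
      (∀ A ∈ 𝒜, A ∈ powersetCard (a + 1) (S.erase p)) ∧
      (∀ B ∈ F.filter (p ∉ ·), B ∈ powersetCard (a + 2) (S.erase p)) ∧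
      ∀ A ∈ 𝒜, ∀ B ∈ F.filter (p ∉ ·), (A ∩ B).Nonempty := by
  obtain ⟨𝒜, hc, h𝒜⟩ := exists_link (p := p) (G := F.filter (p ∈ ·))
    (fun A hA => (mem_filter.1 hA).2)
  refine ⟨𝒜, ?_, by rw [card_erase_of_mem hp, hS]; rfl, fun D hD => ?_, fun B hB => ?_,
    fun D hD B hB => ?_⟩
  · rw [hc, card_filter_add_card_filter_not]
  · obtain ⟨A, hA, rfl⟩ := (h𝒜 D).1 hD
    rw [mem_filter] at hA
    obtain ⟨hAS, hAc⟩ := mem_powersetCard.1 (hF A hA.1)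
    rw [mem_powersetCard, card_erase_of_mem hA.2, hAc]
    exact ⟨erase_subset_erase p hAS, rfl⟩
  · rw [mem_filter] at hB
    obtain ⟨hBS, hBc⟩ := mem_powersetCard.1 (hF B hB.1)
    exact mem_powersetCard.2 ⟨subset_erase.2 ⟨hBS, hB.2⟩, hBc⟩
  · obtain ⟨A, hA, rfl⟩ := (h𝒜 D).1 hD
    rw [mem_filter] at hA hB
    obtain ⟨z, hz⟩ := hint A hA.1 B hB.1
    rw [mem_inter] at hz
    exact ⟨z, mem_inter.2 ⟨mem_erase.2 ⟨fun h => hB.2 (h ▸ hz.2), hz.1⟩, hz.2⟩⟩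

theorem card_add_le_of_card_filter_le (hS : #S = a + r + 4)
    (hF : ∀ A ∈ F, A ∈ powersetCard (a + 2) S) (hint : ∀ A ∈ F, ∀ B ∈ F, (A ∩ B).Nonempty)
    (ha : 4 ≤ a) (h : 13 * a ≤ 5 * r + 1) {p : α} (hp : p ∈ S)
    (h1 : r + 3 ≤ #(F.filter (p ∉ ·))) (h2 : #(F.filter (p ∉ ·)) ≤ (a + r + 1).choose (r + 1)) :
    #F + (r + 2).choose (a + 1) ≤ (a + r + 3).choose (a + 1) := by
  obtain ⟨𝒜, hc, hV, h𝒜, hℬ, hcross⟩ := exists_link_filter hS hF hint hp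
  obtain ⟨x, y, hry, hrx, hyx, hxar, hle, hge⟩ := exists_cascade ha h h1 h2
  have key := card_add_le_of_cross_intersecting (r := r) (a := a) (x := x) (y := y)
    (fun A hA => (mem_powersetCard.1 (h𝒜 A hA)).1) (fun B hB => (mem_powersetCard.1 (hℬ B hB)).1)
    (fun A hA => (mem_powersetCard.1 (h𝒜 A hA)).2)
    (fun B hB => by rw [(mem_powersetCard.1 (hℬ B hB)).2, hV]; omega)
    hcross (by omega) hry hrx hyx (by omega) hle
  rw [hV] at key
  omega

/-- A bound for families with few members missing two points `i` and `j`. -/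
theorem card_add_le_of_card_filter_not_not_le (hS : #S = a + r + 4)
    (hF : ∀ A ∈ F, A ∈ powersetCard (a + 2) S) (hint : ∀ A ∈ F, ∀ B ∈ F, (A ∩ B).Nonempty)
    (ha : 4 ≤ a) (h : 13 * a ≤ 5 * r + 1) {i j : α}
    (hi : i ∈ S) (hj : j ∈ S) (hij : i ≠ j)
    (h0 : #(F.filter (fun A => i ∉ A ∧ j ∉ A)) ≤ r + 2)
    (hγi : (a + r + 1).choose (r + 1) < #(F.filter (i ∉ ·)))
    (hγj : (a + r + 1).choose (r + 1) < #(F.filter (j ∉ ·))) :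
    #F + (r + 2).choose (a + 1) ≤ (a + r + 3).choose (a + 1) + (r + 2) := by
  have hV : #((S.erase i).erase j) = a + r + 2 := by
    rw [card_erase_of_mem (mem_erase.2 ⟨hij.symm, hj⟩), card_erase_of_mem hi, hS]; rfl
  have hθ : 2 * (r + 2) ≤ (a + r + 1).choose (r + 1) := by
    have h1 := choose_two_le_choose (r := r) (a := a) (by omega) ha (by omega)
    have h2 := Nat.choose_le_choose a (show r ≤ a + r + 1 by omega)
    rw [Nat.choose_symm_of_eq_add (show a + r + 1 = r + 1 + a by omega)]
    have h3 : (r + 3).choose 2 * 2 = (r + 3) * (r + 2) := by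
      rw [Nat.choose_two_right, Nat.div_mul_cancel (even_iff_two_dvd.1 (Nat.even_mul_pred_self _))]
      rfl
    nlinarith
  have hsplit : ∀ p q : α, #(F.filter (p ∉ ·)) =
      #(F.filter (fun A => q ∈ A ∧ p ∉ A)) + #(F.filter (fun A => p ∉ A ∧ q ∉ A)) := by
    intro p q
    rw [← card_filter_add_card_filter_not (s := F.filter (p ∉ ·)) (q ∈ ·), filter_filter,
      filter_filter]
    simp only [and_comm]
  have hPQ : ∀ p q : α, p ∈ S → q ∈ S → p ≠ q →
      ∃ 𝒜 : Finset (Finset α), #𝒜 = #(F.filter (fun A => p ∈ A ∧ q ∉ A)) ∧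
        (∀ D ∈ 𝒜, D ∈ powersetCard (a + 1) ((S.erase p).erase q)) ∧
        ∀ D ∈ 𝒜, insert p D ∈ F := by
    intro p q hp hq hpq
    obtain ⟨𝒜, hc, h𝒜⟩ := exists_link (p := p) (G := F.filter (fun A => p ∈ A ∧ q ∉ A))
      (fun A hA => (mem_filter.1 hA).2.1)
    refine ⟨𝒜, hc, fun D hD => ?_, fun D hD => ?_⟩ <;> obtain ⟨A, hA, rfl⟩ := (h𝒜 D).1 hD <;>
      rw [mem_filter] at hA
    · obtain ⟨hAS, hAc⟩ := mem_powersetCard.1 (hF A hA.1)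
      rw [mem_powersetCard, card_erase_of_mem hA.2.1, hAc, subset_erase]
      exact ⟨⟨erase_subset_erase p hAS, fun h => hA.2.2 (mem_of_mem_erase h)⟩, rfl⟩
    · rw [insert_erase hA.2.1]; exact hA.1
  obtain ⟨𝒞, hPc, hP, hPF⟩ := hPQ i j hi hj hij
  obtain ⟨𝒟, hQc, hQ, hQF⟩ := hPQ j i hj hi hij.symm
  rw [erase_right_comm] at hQ
  have hcross : ∀ A ∈ 𝒞, ∀ B ∈ 𝒟, (A ∩ B).Nonempty := by
    intro A hA B hB
    have hA' := (mem_powersetCard.1 (hP A hA)).1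
    have hB' := (mem_powersetCard.1 (hQ B hB)).1
    obtain ⟨z, hz⟩ := hint _ (hPF A hA) _ (hQF B hB)
    rw [mem_inter, mem_insert, mem_insert] at hz
    rcases hz with ⟨rfl | hzA, rfl | hzB⟩
    · exact absurd rfl hij
    · exact absurd (hB' hzB) (by simp)
    · exact absurd (hA' hzA) (by simp)
    · exact ⟨z, mem_inter.2 ⟨hzA, hzB⟩⟩
  have hboth : #(F.filter (fun A => i ∈ A ∧ j ∈ A)) ≤ (a + r + 2).choose a := by
    rw [← hV, ← card_powersetCard]
    refine card_le_card_of_injOn (fun A => (A.erase i).erase j) ?_ ?_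
    · intro A hA
      rw [mem_coe, mem_filter] at hA
      obtain ⟨hAS, hAc⟩ := mem_powersetCard.1 (hF A hA.1)
      rw [mem_coe, mem_powersetCard, card_erase_of_mem (mem_erase.2 ⟨hij.symm, hA.2.2⟩),
        card_erase_of_mem hA.2.1, hAc]
      exact ⟨erase_subset_erase _ (erase_subset_erase _ hAS), rfl⟩
    · intro A hA B hB hAB
      rw [mem_coe, mem_filter] at hA hB
      have hAB' : (A.erase i).erase j = (B.erase i).erase j := hAB
      rw [← insert_erase hA.2.1, ← insert_erase hB.2.1,
        ← insert_erase (mem_erase.2 ⟨hij.symm, hA.2.2⟩),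
        ← insert_erase (mem_erase.2 ⟨hij.symm, hB.2.2⟩), hAB']
  have hi' := hsplit i j
  have hj' := hsplit j i
  have hcomm : #(F.filter (fun A => j ∉ A ∧ i ∉ A)) = #(F.filter (fun A => i ∉ A ∧ j ∉ A)) := by
    simp only [and_comm]
  have htot : #F = #(F.filter (fun A => i ∈ A ∧ j ∈ A)) + #(F.filter (fun A => i ∈ A ∧ j ∉ A)) +
      #(F.filter (i ∉ ·)) := by
    rw [← card_filter_add_card_filter_not (s := F) (i ∈ ·),
      ← card_filter_add_card_filter_not (s := F.filter (i ∈ ·)) (j ∈ ·), filter_filter,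
      filter_filter]
  have hpascal : (a + r + 3).choose (a + 1) = (a + r + 2).choose a + (a + r + 2).choose (a + 1) :=
    Nat.choose_succ_succ' (a + r + 2) a
  rcases le_total #𝒟 #𝒞 with hle | hle
  · have := card_add_card_le_of_cross_intersecting hV hP hQ hcross ha h (by omega) hle
    omega
  · have := card_add_card_le_of_cross_intersecting hV hQ hP
      (fun A hA B hB => by rw [inter_comm]; exact hcross B hB A hA) ha h (by omega) hle
    omega

end Links

section Shifting

/-- The shift replacing `j` by `i` in every member of `F` for which this leads out of `F`. -/
def shiftMember {α : Type*} [DecidableEq α] (F : Finset (Finset α)) (i j : α) (A : Finset α) :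
    Finset α :=
  if j ∈ A ∧ i ∉ A ∧ insert i (A.erase j) ∉ F then insert i (A.erase j) else A

section Basic

variable {α : Type*} [DecidableEq α] {F : Finset (Finset α)} {i j : α}

theorem shiftMember_injOn : Set.InjOn (shiftMember F i j) F := by
  intro A hA B hB h
  rw [mem_coe] at hA hB
  unfold shiftMember at h
  split_ifs at h with h1 h2 h2
  · have h3 := congrArg (fun C => insert j (C.erase i)) h
    beta_reduce at h3
    rwa [erase_insert (fun h => h1.2.1 (mem_of_mem_erase h)), insert_erase h1.1,
      erase_insert (fun h => h2.2.1 (mem_of_mem_erase h)), insert_erase h2.1] at h3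
  · exact absurd (h ▸ hB) h1.2.2
  · exact absurd (h ▸ hA) h2.2.2
  · exact h

theorem shiftMember_mem_powersetCard {S A : Finset α} {k : ℕ} (hi : i ∈ S)
    (hA : A ∈ powersetCard k S) : shiftMember F i j A ∈ powersetCard k S := by
  rw [mem_powersetCard] at hA ⊢
  unfold shiftMember
  split_ifs with h
  · rw [card_insert_of_notMem (fun h' => h.2.1 (mem_of_mem_erase h')), card_erase_add_one h.1]
    exact ⟨insert_subset hi ((erase_subset j A).trans hA.1), hA.2⟩
  · exact hA

theorem shiftMember_inter_nonempty (hint : ∀ A ∈ F, ∀ B ∈ F, (A ∩ B).Nonempty) {A B : Finset α}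
    (hA : A ∈ F) (hB : B ∈ F) : (shiftMember F i j A ∩ shiftMember F i j B).Nonempty := by
  have key : ∀ A ∈ F, ∀ B ∈ F, (j ∈ A ∧ i ∉ A ∧ insert i (A.erase j) ∉ F) →
      ¬ (j ∈ B ∧ i ∉ B ∧ insert i (B.erase j) ∉ F) → (insert i (A.erase j) ∩ B).Nonempty := by
    intro A hA B hB h1 h2
    by_cases hiB : i ∈ B
    · exact ⟨i, mem_inter.2 ⟨mem_insert_self _ _, hiB⟩⟩
    by_cases hjB : j ∈ B
    · have hB' : insert i (B.erase j) ∈ F := by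
        by_contra h3
        exact h2 ⟨hjB, hiB, h3⟩
      obtain ⟨z, hz⟩ := hint A hA _ hB'
      rw [mem_inter, mem_insert, mem_erase] at hz
      rcases hz with ⟨hzA, rfl | hzB⟩
      · exact absurd hzA h1.2.1
      · exact ⟨z, mem_inter.2 ⟨mem_insert_of_mem (mem_erase.2 ⟨hzB.1, hzA⟩), hzB.2⟩⟩
    · obtain ⟨z, hz⟩ := hint A hA B hB
      rw [mem_inter] at hz
      exact ⟨z, mem_inter.2 ⟨mem_insert_of_mem (mem_erase.2 ⟨fun h => hjB (h ▸ hz.2), hz.1⟩),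
        hz.2⟩⟩
  unfold shiftMember
  split_ifs with h1 h2 h2
  · exact ⟨i, mem_inter.2 ⟨mem_insert_self _ _, mem_insert_self _ _⟩⟩
  · exact key A hA B hB h1 h2
  · rw [inter_comm]
    exact key B hB A hA h2 h1
  · exact hint A hA B hB

theorem card_filter_image_shiftMember (q : Finset α → Prop) [DecidablePred q] :
    #((F.image (shiftMember F i j)).filter q) = #(F.filter (fun A => q (shiftMember F i j A))) := by
  rw [filter_image]
  exact card_image_of_injOn (shiftMember_injOn.mono (coe_subset.2 (filter_subset _ _)))

theorem card_filter_le_card_filter_image_shiftMember {p : α} (hp : p ≠ i) :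
    #(F.filter (p ∉ ·)) ≤ #((F.image (shiftMember F i j)).filter (p ∉ ·)) := by
  rw [card_filter_image_shiftMember]
  refine card_le_card fun A hA => ?_
  rw [mem_filter] at hA ⊢
  refine ⟨hA.1, ?_⟩
  unfold shiftMember
  split_ifs
  · simp [hp, hA.2]
  · exact hA.2

theorem card_filter_not_not_le_card_filter_image_shiftMember :
    #(F.filter (fun A => i ∉ A ∧ j ∉ A)) ≤
      #((F.image (shiftMember F i j)).filter (i ∉ ·)) := by
  rw [card_filter_image_shiftMember]
  refine card_le_card fun A hA => ?_
  rw [mem_filter] at hA ⊢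
  rw [shiftMember, if_neg fun h => hA.2.2 h.1]
  exact ⟨hA.1, hA.2.1⟩

end Basic

theorem sum_shiftMember_le {F : Finset (Finset ℕ)} {i j : ℕ} (hij : i < j) (A : Finset ℕ) :
    ∑ x ∈ shiftMember F i j A, x ≤ ∑ x ∈ A, x ∧
      (shiftMember F i j A ≠ A → ∑ x ∈ shiftMember F i j A, x < ∑ x ∈ A, x) := by
  unfold shiftMember
  split_ifs with h
  · have h1 := sum_erase_add A (fun x => x) h.1
    rw [sum_insert fun h' => h.2.1 (mem_of_mem_erase h')]
    beta_reduce at h1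
    exact ⟨by omega, fun _ => by omega⟩
  · exact ⟨le_rfl, fun h => absurd rfl h⟩

theorem sum_image_shiftMember_lt {F : Finset (Finset ℕ)} {i j : ℕ} (hij : i < j) {A : Finset ℕ}
    (hA : A ∈ F) (hjA : j ∈ A) (hiA : i ∉ A) (hAF : insert i (A.erase j) ∉ F) :
    ∑ B ∈ F.image (shiftMember F i j), ∑ x ∈ B, x < ∑ B ∈ F, ∑ x ∈ B, x := by
  rw [sum_image shiftMember_injOn]
  refine sum_lt_sum (fun B _ => (sum_shiftMember_le hij B).1)
    ⟨A, hA, (sum_shiftMember_le hij A).2 fun h => ?_⟩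
  rw [shiftMember, if_pos ⟨hjA, hiA, hAF⟩] at h
  exact hiA (h ▸ mem_insert_self _ _)

/-- Closure under replacing an element of `S` by a smaller one. -/
def IsShifted (S : Finset ℕ) (F : Finset (Finset ℕ)) : Prop :=
  ∀ i ∈ S, ∀ j ∈ S, i < j → ∀ A ∈ F, j ∈ A → i ∉ A → insert i (A.erase j) ∈ F

theorem IsShifted.filter_notMem {m u : ℕ} {F : Finset (Finset ℕ)} (h : IsShifted (Ico m u) F) :
    IsShifted (Ico (m + 1) u) (F.filter (m ∉ ·)) := by
  intro i hi j hj hij A hA hjA hiA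
  rw [mem_Ico] at hi hj
  rw [mem_filter] at hA ⊢
  refine ⟨h i (mem_Ico.2 (by omega)) j (mem_Ico.2 (by omega)) hij A hA.1 hjA hiA, ?_⟩
  rw [mem_insert, mem_erase, not_or]
  exact ⟨by omega, fun h => hA.2 h.2⟩

theorem IsShifted.le_card_inter {m u t : ℕ} {F : Finset (Finset ℕ)} (h : IsShifted (Ico m u) F)
    (hF : ∀ A ∈ F, A ⊆ Ico m u) (ht : 1 ≤ t) (hint : ∀ A ∈ F, ∀ B ∈ F, t ≤ #(A ∩ B)) :
    ∀ A ∈ F.filter (m ∉ ·), ∀ B ∈ F.filter (m ∉ ·), t + 1 ≤ #(A ∩ B) := by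
  intro A hA B hB
  rw [mem_filter] at hA hB
  obtain ⟨j, hj⟩ := card_pos.1 (ht.trans (hint A hA.1 B hB.1))
  have hjA := (mem_inter.1 hj).1
  have hju := mem_Ico.1 (hF A hA.1 hjA)
  have hmj : m < j := lt_of_le_of_ne hju.1 fun h => hA.2 (h ▸ hjA)
  have h1 := hint _ (h m (mem_Ico.2 (by omega)) j (mem_Ico.2 hju) hmj A hA.1 hjA hA.2) B hB.1
  rw [insert_inter_of_notMem hB.2, erase_inter, card_erase_of_mem hj] at h1
  omega

theorem IsShifted.card_le {N : ℕ} : ∀ {m t d : ℕ} {F : Finset (Finset ℕ)},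
    IsShifted (Ico m (m + N)) F → (∀ A ∈ F, A ∈ powersetCard (t + d) (Ico m (m + N))) →
    (∀ A ∈ F, ∀ B ∈ F, t ≤ #(A ∩ B)) → #F ≤ N.choose d := by
  induction N with
  | zero =>
    intro m t d F _ hF _
    rw [Nat.add_zero, Ico_self] at hF
    have h1 := card_le_card (show F ⊆ powersetCard (t + d) ∅ from hF)
    rw [card_powersetCard, card_empty] at h1
    rcases Nat.eq_zero_or_pos d with rfl | hd
    · refine h1.trans ?_
      rcases t with _ | t <;> simp
    · rw [Nat.choose_eq_zero_of_lt (by omega)] at h1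
      omega
  | succ N ih =>
    intro m t d F hsh hF hint
    rcases t with _ | s
    · have h1 := card_le_card (show F ⊆ powersetCard (0 + d) (Ico m (m + (N + 1))) from hF)
      rwa [card_powersetCard, Nat.card_Ico, Nat.zero_add, Nat.add_sub_cancel_left] at h1
    have hsub : ∀ A ∈ F, A ⊆ Ico m (m + (N + 1)) := fun A hA => (mem_powersetCard.1 (hF A hA)).1
    rw [show m + (N + 1) = m + 1 + N by omega] at hsh hF hsub
    have herase : ∀ A ⊆ Ico m (m + 1 + N), A.erase m ⊆ Ico (m + 1) (m + 1 + N) := by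
      intro A hA x hx
      rw [mem_erase] at hx
      have := mem_Ico.1 (hA hx.2)
      exact mem_Ico.2 (by omega)
    have h0 : #(F.filter (m ∈ ·)) ≤ N.choose d := by
      obtain ⟨𝒜, hc, h𝒜⟩ := exists_link (p := m) (G := F.filter (m ∈ ·))
        (fun A hA => (mem_filter.1 hA).2)
      rw [← hc]
      refine ih (m := m + 1) (t := s) ?_ (fun D hD => ?_) (fun D hD E hE => ?_)
      · intro i hi j hj hij D hD hjD hiD
        obtain ⟨A, hA, rfl⟩ := (h𝒜 D).1 hD
        rw [mem_filter] at hA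
        rw [mem_Ico] at hi hj
        have hjA := mem_of_mem_erase hjD
        have hiA : i ∉ A := fun h => hiD (mem_erase.2 ⟨by omega, h⟩)
        refine (h𝒜 _).2 ⟨insert i (A.erase j), mem_filter.2 ⟨hsh i (mem_Ico.2 (by omega)) j
          (mem_Ico.2 (by omega)) hij A hA.1 hjA hiA, ?_⟩, ?_⟩
        · exact mem_insert_of_mem (mem_erase.2 ⟨by omega, hA.2⟩)
        · rw [erase_insert_of_ne (by omega), erase_right_comm]
      · obtain ⟨A, hA, rfl⟩ := (h𝒜 D).1 hD
        rw [mem_filter] at hA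
        rw [mem_powersetCard, card_erase_of_mem hA.2, (mem_powersetCard.1 (hF A hA.1)).2]
        exact ⟨herase A (hsub A hA.1), by omega⟩
      · obtain ⟨A, hA, rfl⟩ := (h𝒜 D).1 hD
        obtain ⟨B, hB, rfl⟩ := (h𝒜 E).1 hE
        rw [mem_filter] at hA hB
        rw [inter_erase, erase_inter, erase_idem, card_erase_of_mem (mem_inter.2 ⟨hA.2, hB.2⟩)]
        have := hint A hA.1 B hB.1
        omega
    have h1 : #(F.filter (m ∉ ·)) ≤ if d = 0 then 0 else N.choose (d - 1) := by
      have hint' := hsh.le_card_inter hsub (by omega) hint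
      split_ifs with hd
      · rw [Nat.le_zero, card_eq_zero, eq_empty_iff_forall_notMem]
        intro A hA
        have h2 := hint' A hA A hA
        rw [inter_self, (mem_powersetCard.1 (hF A (mem_filter.1 hA).1)).2] at h2
        omega
      · refine ih (t := s + 1 + 1) hsh.filter_notMem (fun A hA => ?_) hint'
        rw [mem_filter] at hA
        have h2 := herase A (hsub A hA.1)
        rw [erase_eq_of_notMem hA.2] at h2
        rw [mem_powersetCard, (mem_powersetCard.1 (hF A hA.1)).2]
        exact ⟨h2, by omega⟩
    rw [← card_filter_add_card_filter_not (s := F) (m ∈ ·)]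
    rcases d with _ | e
    · rw [if_pos rfl] at h1
      rw [Nat.choose_zero_right] at h0 ⊢
      omega
    · rw [Nat.choose_succ_succ']
      rw [if_neg (by omega), Nat.add_sub_cancel] at h1
      omega

end Shifting

section Bound

variable {a r n : ℕ} {F : Finset (Finset ℕ)}

theorem card_add_le_of_isShifted (ha : 4 ≤ a) (h : 13 * a ≤ 5 * r + 1) (hn : n = a + r + 4)
    (hF : ∀ A ∈ F, A ∈ powersetCard (a + 2) (Icc 1 n))
    (hint : ∀ A ∈ F, ∀ B ∈ F, (A ∩ B).Nonempty) (hsh : IsShifted (Icc 1 n) F)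
    (h1 : (a + r + 1).choose (r + 1) < #(F.filter (1 ∉ ·))) :
    #F + (r + 2).choose (a + 1) ≤ (a + r + 3).choose (a + 1) := by
  have hI : ∀ m, Icc m n = Ico m (n + 1) := fun m => rfl
  have hS : #(Icc 1 n) = a + r + 4 := by rw [Nat.card_Icc, hn]; rfl
  obtain ⟨𝒜, hc, hV, h𝒜, hℬ, hcross⟩ :=
    exists_link_filter hS hF hint (p := 1) (mem_Icc.2 (by omega))
  have h𝒜c := card_add_le_of_cross_intersecting (r := r) (a := a) (x := a + r) (y := a + r)
    (fun A hA => (mem_powersetCard.1 (h𝒜 A hA)).1) (fun B hB => (mem_powersetCard.1 (hℬ B hB)).1)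
    (fun A hA => (mem_powersetCard.1 (h𝒜 A hA)).2)
    (fun B hB => by rw [(mem_powersetCard.1 (hℬ B hB)).2, hV]; omega)
    hcross (by omega) (by omega) (by omega) le_rfl (by omega)
    (by rw [Nat.choose_succ_succ' (a + r) r] at h1; omega)
  rw [hV] at h𝒜c
  have hpascal : (a + r + 1).choose (a + 1) = (a + r).choose a + (a + r).choose (a + 1) :=
    Nat.choose_succ_succ' (a + r) a
  have hV' : #(Icc 3 n) = a + r + 2 := by rw [Nat.card_Icc, hn]; rfl
  have hsub : ∀ A ∈ F, A ⊆ Ico 1 (n + 1) := fun A hA => (mem_powersetCard.1 (hF A hA)).1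
  have hint₂ := IsShifted.le_card_inter hsh hsub le_rfl
    (fun A hA B hB => card_pos.2 (hint A hA B hB))
  have hsh₂ := IsShifted.filter_notMem hsh
  have hsub₂ : ∀ A ∈ F.filter (1 ∉ ·), A ⊆ Ico 2 (n + 1) := by
    intro A hA x hx
    rw [mem_filter] at hA
    have h1 := mem_Ico.1 (hsub A hA.1 hx)
    have h2 : x ≠ 1 := fun h => hA.2 (h ▸ hx)
    exact mem_Ico.2 (by omega)
  have hint₃ := hsh₂.le_card_inter hsub₂ (by omega) hint₂
  have hsh₃ := hsh₂.filter_notMem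
  have hF₃ : #((F.filter (1 ∉ ·)).filter (2 ∉ ·)) ≤ (a + r + 2).choose (r + 3) := by
    rw [Nat.choose_symm_of_eq_add (show a + r + 2 = r + 3 + (a - 1) by omega)]
    have e : n + 1 = 3 + (a + r + 2) := by omega
    rw [e] at hsh₃ hsub₂
    refine hsh₃.card_le (t := 3) (fun A hA => ?_) hint₃
    rw [mem_filter] at hA
    rw [mem_powersetCard, (mem_powersetCard.1 (hF A (mem_filter.1 hA.1).1)).2]
    refine ⟨fun x hx => ?_, by omega⟩
    have h1 := mem_Ico.1 (hsub₂ A hA.1 hx)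
    have h2 : x ≠ 2 := by rintro rfl; exact hA.2 hx
    exact mem_Ico.2 (by omega)
  have hF₂ : #((F.filter (1 ∉ ·)).filter (2 ∈ ·)) ≤ (a + r + 1).choose (r + 1) := by
    obtain ⟨𝒞, hc, h𝒞⟩ := exists_link (p := 2) (G := (F.filter (1 ∉ ·)).filter (2 ∈ ·))
      (fun A hA => (mem_filter.1 hA).2)
    have h𝒞' : ∀ D ∈ 𝒞, D ∈ powersetCard (a + 1) (Icc 3 n) := by
      intro D hD
      obtain ⟨A, hA, rfl⟩ := (h𝒞 D).1 hD
      rw [mem_filter] at hA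
      rw [mem_powersetCard, card_erase_of_mem hA.2,
        (mem_powersetCard.1 (hF A (mem_filter.1 hA.1).1)).2]
      refine ⟨fun x hx => ?_, rfl⟩
      rw [mem_erase] at hx
      have h1 := mem_Ico.1 (hsub₂ A hA.1 hx.2)
      exact mem_Icc.2 (by omega)
    have hint𝒞 : ∀ D ∈ 𝒞, ∀ E ∈ 𝒞, (D ∩ E).Nonempty := by
      intro D hD E hE
      obtain ⟨A, hA, rfl⟩ := (h𝒞 D).1 hD
      obtain ⟨B, hB, rfl⟩ := (h𝒞 E).1 hE
      rw [mem_filter] at hA hB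
      have := hint₂ A hA.1 B hB.1
      rw [← card_pos, inter_erase, erase_inter, erase_idem,
        card_erase_of_mem (mem_inter.2 ⟨hA.2, hB.2⟩)]
      omega
    rw [← hc]
    by_contra! hlt
    have := card_le_of_cross_intersecting hV' h𝒞' h𝒞' hint𝒞 (by omega) (by omega) hlt.le
    omega
  rw [← card_filter_add_card_filter_not (s := F.filter (1 ∉ ·)) (2 ∈ ·)] at hc
  have := choose_loss_shifted ha h
  omega

theorem card_add_le_of_forall_card_filter_gt (ha : 4 ≤ a) (h : 13 * a ≤ 5 * r + 1)
    (hn : n = a + r + 4) (hF : ∀ A ∈ F, A ∈ powersetCard (a + 2) (Icc 1 n))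
    (hint : ∀ A ∈ F, ∀ B ∈ F, (A ∩ B).Nonempty)
    (hγ : ∀ p ∈ Icc 1 n, (a + r + 1).choose (r + 1) < #(F.filter (p ∉ ·))) :
    #F + (r + 2).choose (a + 1) ≤ (a + r + 3).choose (a + 1) + (r + 2) := by
  have hS : #(Icc 1 n) = a + r + 4 := by rw [Nat.card_Icc, hn]; rfl
  induction hw : ∑ A ∈ F, ∑ x ∈ A, x using Nat.strong_induction_on generalizing F with
  | _ w ih =>
    by_cases hsh : IsShifted (Icc 1 n) F
    · exact (card_add_le_of_isShifted ha h hn hF hint hsh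
        (hγ 1 (mem_Icc.2 (by omega)))).trans (Nat.le_add_right _ _)
    unfold IsShifted at hsh
    push Not at hsh
    obtain ⟨i, hi, j, hj, hij, A, hA, hjA, hiA, hAF⟩ := hsh
    have hlt := sum_image_shiftMember_lt hij hA hjA hiA hAF
    have hcard : #(F.image (shiftMember F i j)) = #F := card_image_of_injOn shiftMember_injOn
    have hF' : ∀ B ∈ F.image (shiftMember F i j), B ∈ powersetCard (a + 2) (Icc 1 n) := by
      intro B hB
      obtain ⟨A, hA, rfl⟩ := mem_image.1 hB
      exact shiftMember_mem_powersetCard hi (hF A hA)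
    have hint' : ∀ B ∈ F.image (shiftMember F i j), ∀ C ∈ F.image (shiftMember F i j),
        (B ∩ C).Nonempty := by
      intro B hB C hC
      obtain ⟨A, hA, rfl⟩ := mem_image.1 hB
      obtain ⟨D, hD, rfl⟩ := mem_image.1 hC
      exact shiftMember_inter_nonempty hint hA hD
    by_cases hγ' : ∀ p ∈ Icc 1 n,
        (a + r + 1).choose (r + 1) < #((F.image (shiftMember F i j)).filter (p ∉ ·))
    · rw [← hcard]
      exact ih _ (hw ▸ hlt) hF' hint' hγ' rfl
    push Not at hγ'
    obtain ⟨p, hp, hpγ⟩ := hγ'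
    have hpi : p = i := by
      by_contra hpi
      have h1 := hγ p hp
      have h2 := card_filter_le_card_filter_image_shiftMember (F := F) (j := j) hpi
      omega
    subst hpi
    by_cases hbig : r + 3 ≤ #((F.image (shiftMember F p j)).filter (p ∉ ·))
    · rw [← hcard]
      exact (card_add_le_of_card_filter_le hS hF' hint' ha h hp hbig hpγ).trans
        (Nat.le_add_right _ _)
    · have h1 := card_filter_not_not_le_card_filter_image_shiftMember (F := F) (i := p) (j := j)
      exact card_add_le_of_card_filter_not_not_le hS hF hint ha h hp hj hij.ne (by omega)
        (hγ p hp) (hγ j hj)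

end Bound

theorem t_level_stability (n k t : ℕ) (ht : 4 ≤ t) (hk : t + 2 ≤ k)
    (hn : ((5 + Real.sqrt 5) * k - 7) / 2 < (n : ℝ))
    (F : Finset (Finset ℕ))
    (hF : ∀ A ∈ F, A ∈ (Finset.Icc 1 n).powersetCard k)
    (hint : ∀ A ∈ F, ∀ B ∈ F, (A ∩ B).Nonempty)
    (hnontriv : ¬ ∃ p, ∀ A ∈ F, p ∈ A)
    (hnotM : ∀ t₀ : ℕ, 2 ≤ t₀ → t₀ ≤ t → ∀ σ : Equiv.Perm ℕ,
      (Finset.Icc 1 n).image σ = Finset.Icc 1 n →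
      ¬ ∀ A ∈ F, A.image σ ∈ familyMkj n k (t₀ - 1)) :
    F.card ≤ (n - 1).choose (k - 1) - (∑ j ∈ Finset.Icc 1 t, (n - k - j).choose (k - j)) + t := by
  obtain ⟨a, rfl⟩ : ∃ a, k = a + 2 := ⟨k - 2, by omega⟩
  have hnk : a + 4 ≤ n := by
    have h6 : (4 : ℝ) ≤ a := by exact_mod_cast (show 4 ≤ a by omega)
    have h0 := Real.sqrt_nonneg 5
    have : (a + 4 : ℝ) < n := by
      push_cast at hn
      nlinarith
    exact_mod_cast this.le
  obtain ⟨r, hr⟩ : ∃ r, n = a + r + 4 := ⟨n - (a + 4), by omega⟩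
  obtain ⟨h, hgolden⟩ := nat_bounds_of_sqrt_lt (a := a) (r := r) (by omega) (hr ▸ hn)
  have hnum := choose_pred_le_choose_of_mul_le (by omega) (by omega) hgolden
  have hsum := sum_choose_sub_add a r (t := t) (by omega) (by omega)
  have hanti := choose_sub_add_antitone (a := a) (r := r) (s := t) (t := a + 1)
    (by omega) (by omega) le_rfl
  rw [show r + 2 - (a + 1) = r + 1 - a by omega, Nat.sub_self, Nat.choose_zero_right] at hanti
  have hanti' := choose_sub_add_antitone (a := a) (r := r) (s := t) (t := a)
    (by omega) (by omega) (by omega)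
  rw [show a + 1 - a = 1 by omega, Nat.choose_one_right] at hanti'
  rw [show n - 1 = a + r + 3 by omega, show a + 2 - 1 = a + 1 by omega,
    show n - (a + 2) = r + 2 by omega]
  have hL : (r + 2).choose (a + 1) ≤ (a + r + 3).choose (a + 1) :=
    Nat.choose_le_choose _ (by omega)
  suffices hmain : #F + (r + 2).choose (a + 1) ≤ (a + r + 3).choose (a + 1) +
      ((r + 2 - t).choose (a + 1 - t) + t) by omega
  have hS : #(Icc 1 n) = a + r + 4 := by rw [Nat.card_Icc, hr]; rfl
  by_cases hall : ∀ p ∈ Icc 1 n, (a + r + 1).choose (r + 1) < #(F.filter (p ∉ ·))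
  · have := card_add_le_of_forall_card_filter_gt (by omega) h hr hF hint hall
    omega
  push Not at hall
  obtain ⟨p, hp, hpγ⟩ := hall
  by_cases hbig : r + 3 ≤ #(F.filter (p ∉ ·))
  · have := card_add_le_of_card_filter_le hS hF hint (by omega) h hp hbig hpγ
    omega
  obtain ⟨𝒜, hc, hV, h𝒜, hℬ, hcross⟩ := exists_link_filter hS hF hint hp
  have hne : (F.filter (p ∉ ·)).Nonempty := by
    by_contra hne
    rw [not_nonempty_iff_eq_empty, filter_eq_empty_iff] at hne
    exact hnontriv ⟨p, fun A hA => not_not.1 (hne hA)⟩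
  rcases exists_kernel_or_card_add_le hV h𝒜 hℬ hcross hne (by omega) (by omega) hnum with
    ⟨K, hKV, hK, hKℬ⟩ | hle
  · obtain ⟨Y, hY, -, hYc, hYℬ⟩ := exists_eq_image_insert hV hℬ hKV hK hKℬ
    obtain ⟨hs, hle⟩ := card_add_le_of_kernel hV h𝒜 hℬ hcross hKV hK hKℬ
    have hpos := hne.card_pos
    have hst : t ≤ #(F.filter (p ∉ ·)) := by
      by_contra! hlt
      obtain ⟨σ, hσ, hσF⟩ := exists_perm_image_mem_familyMkj hF hint hp hKV (by omega) hY hYℬ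
      refine hnotM (#Y + 1) (by omega) (by omega) σ hσ ?_
      rwa [Nat.add_sub_cancel]
    split_ifs at hle with hsa
    · have := choose_sub_add_antitone (a := a) (r := r) (by omega) hst hsa
      omega
    · omega
  · omega
end
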